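/- arXiv:1411.6488 — 5 statements merged into one kernel-verified Lean document; each statement's English description precedes it below -/
import Mathlib

section
/- Assume condition (C). Let t : ℂ → ℂ be of t-form with det D_t^{(n)} = 0 for all n = 1,…,N. Then there exist ε ∈ {−1, +1} and a function Q of form (Q2) such that: t(λ)·w_ε(λ) = Q(λ+η)Q(λ+iπ−η) − Q(λ+η+iπ)Q(λ−η) for all λ ∈ ℂ; Q satisfies the Wronskian relation with ε; and for each n ∈ {1,…,N} the two vectors u^{(n)} = (Q(ξ_n^{(h)}))_{h=0}^{2s_n} and v^{(n)} = ((−1)^h Q(ξ_n^{(h)}+iπ))_{h=0}^{2s_n} in ℂ^{2s_n+1} are linearly dependent and not both zero. -/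
open Complex Finset

noncomputable section

/-- Shifted inhomogeneity parameter `ξ_n^{(k)} = ξ_n + (s_n − k) η`, where `σ n = 2 s_n`. -/
def xik {N : ℕ} (η : ℂ) (σ : Fin N → ℕ) (ξ : Fin N → ℂ) (n : Fin N) (k : ℕ) : ℂ :=
  ξ n + ((σ n : ℂ) / 2 - (k : ℂ)) * η

/-- `a(λ) = ∏ₙ sinh (λ − ξ_n + s_n η)`. -/
def afun {N : ℕ} (η : ℂ) (σ : Fin N → ℕ) (ξ : Fin N → ℂ) (lam : ℂ) : ℂ :=
  ∏ n, Complex.sinh (lam - ξ n + ((σ n : ℂ) / 2) * η)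

/-- `d(λ) = ∏ₙ sinh (λ − ξ_n − s_n η)`. -/
def dfun {N : ℕ} (η : ℂ) (σ : Fin N → ℕ) (ξ : Fin N → ℂ) (lam : ℂ) : ℂ :=
  ∏ n, Complex.sinh (lam - ξ n - ((σ n : ℂ) / 2) * η)

/-- `t` is of t-form: `t(λ) = e^{−(N−1)λ} ∑_{j=0}^{N−1} c_j e^{2jλ}`. -/
def tForm (N : ℕ) (t : ℂ → ℂ) : Prop :=
  ∃ c : Fin N → ℂ, ∀ lam : ℂ,
    t lam = Complex.exp (-((N : ℂ) - 1) * lam) * ∑ j, c j * Complex.exp (2 * ((j : ℕ) : ℂ) * lam)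

/-- The `(2s_n+1) × (2s_n+1)` tridiagonal matrix `D_t^{(n)}`. -/
def Dmat {N : ℕ} (η : ℂ) (σ : Fin N → ℕ) (ξ : Fin N → ℂ) (t : ℂ → ℂ) (n : Fin N) :
    Matrix (Fin (σ n + 1)) (Fin (σ n + 1)) ℂ :=
  Matrix.of fun h k =>
    if (h : ℕ) = (k : ℕ) then t (xik η σ ξ n (h : ℕ))
    else if (k : ℕ) = (h : ℕ) + 1 then afun η σ ξ (xik η σ ξ n (h : ℕ))
    else if (h : ℕ) = (k : ℕ) + 1 then -(dfun η σ ξ (xik η σ ξ n (h : ℕ)))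
    else 0

/-- The set `Ξ_i = {ξ_i + kη + k′ iπ : k ∈ {−s_i, …, s_i}, k′ ∈ ℤ}`. -/
def XiSet {N : ℕ} (η : ℂ) (σ : Fin N → ℕ) (ξ : Fin N → ℂ) (i : Fin N) : Set ℂ :=
  {z : ℂ | ∃ k : ℕ, k ≤ σ i ∧ ∃ k' : ℤ, z = xik η σ ξ i k + (k' : ℂ) * ((Real.pi : ℂ) * Complex.I)}

/-- Condition (C): the sets `Ξ_i` are pairwise disjoint. -/
def CondC {N : ℕ} (η : ℂ) (σ : Fin N → ℕ) (ξ : Fin N → ℂ) : Prop :=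
  ∀ i j : Fin N, i ≠ j → XiSet η σ ξ i ∩ XiSet η σ ξ j = ∅

/-- The inhomogeneous term `F_x(λ)`. -/
def Ffun {N : ℕ} (η : ℂ) (σ : Fin N → ℕ) (ξ : Fin N → ℂ) (x lam : ℂ) : ℂ :=
  2 * Complex.exp (-(((∑ n, σ n : ℕ) : ℂ) + 1) * η / 2) *
    Complex.sinh (lam - x + (∑ j, ∑ h ∈ Finset.Icc 1 (σ j), xik η σ ξ j h)
      + (((∑ n, σ n : ℕ) : ℂ) + 1) * η / 2) *
    ∏ j, ∏ h ∈ Finset.range (σ j + 1), Complex.sinh (lam - xik η σ ξ j h)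

/-- `w_ε(λ) = 2 ε (i/2)^{N_s} ∏ₙ ∏_{h=1}^{2s_n−1} sinh(λ − ξ_n^{(h)})`. -/
def wfun {N : ℕ} (η : ℂ) (σ : Fin N → ℕ) (ξ : Fin N → ℂ) (ε lam : ℂ) : ℂ :=
  2 * ε * (Complex.I / 2) ^ (∑ n, σ n) *
    ∏ n, ∏ h ∈ Finset.Icc 1 (σ n - 1), Complex.sinh (lam - xik η σ ξ n h)

section Formal

open PowerSeries

variable {K : Type*} [Field K]

/-- A lower triangular homogeneous linear recursion whose only vanishing diagonal entry is the first
one has a solution starting at `1`. -/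
theorem exists_recursive_solution (c : ℕ → ℕ → K) (h0 : c 0 0 = 0)
    (hc : ∀ m, 1 ≤ m → c m m ≠ 0) :
    ∃ q : ℕ → K, q 0 = 1 ∧ ∀ m, ∑ j ∈ Finset.range (m + 1), c m j * q j = 0 := by
  let step : (m : ℕ) → ((j : ℕ) → j < m → K) → K := fun m f =>
    if m = 0 then 1 else -(∑ j : Fin m, c m j * f j j.2) / c m m
  let q : ℕ → K := fun m => Nat.strongRec step m
  have hq (m : ℕ) : q m = if m = 0 then 1 else -(∑ j : Fin m, c m j * q j) / c m m := by
    simp only [q]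
    rw [Nat.strongRec_eq]
  refine ⟨q, by rw [hq]; simp, fun m => ?_⟩
  rcases Nat.eq_zero_or_pos m with rfl | hm
  · simp [h0]
  · rw [Finset.sum_range_succ, hq m, if_neg hm.ne', Finset.sum_range]
    have := hc m hm
    field_simp
    ring

/-- Existence of a normalised formal power series solution of a second order `p`-difference
equation of Baxter type. -/
theorem exists_formal_baxter_solution {p : K} (hp : ∀ m : ℕ, 1 ≤ m → p ^ m ≠ 1)
    {A D T : K⟦X⟧} (hAD : coeff 0 A = coeff 0 D) (hA : coeff 0 A ≠ 0) (hT : coeff 0 T = 0) :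
    ∃ g : K⟦X⟧, coeff 0 g = 1 ∧ D * rescale (p ^ 2) g = T * rescale p g + A * g := by
  obtain ⟨q, hq0, hq⟩ := exists_recursive_solution
    (fun m j => coeff (m - j) D * (p ^ 2) ^ j - coeff (m - j) T * p ^ j - coeff (m - j) A)
    (by simp [hAD, hT]) (by
      intro m hm h
      simp only [Nat.sub_self, hT, ← hAD, zero_mul, sub_zero] at h
      rw [← mul_sub_one, mul_eq_zero, sub_eq_zero, ← pow_mul] at h
      exact h.elim hA (hp _ (by lia)))
  refine ⟨PowerSeries.mk q, by rw [coeff_mk, hq0], ?_⟩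
  rw [← sub_eq_zero, ← sub_sub]
  ext m
  rw [map_sub, map_sub, mul_comm D, mul_comm T, mul_comm A, coeff_mul, coeff_mul, coeff_mul,
    Finset.Nat.sum_antidiagonal_eq_sum_range_succ_mk,
    Finset.Nat.sum_antidiagonal_eq_sum_range_succ_mk,
    Finset.Nat.sum_antidiagonal_eq_sum_range_succ_mk, ← Finset.sum_sub_distrib,
    ← Finset.sum_sub_distrib, map_zero, ← hq m]
  refine Finset.sum_congr rfl fun j _ => ?_
  simp only [coeff_rescale, coeff_mk]
  ring

/-- Solutions of a first order `p`-difference equation are proportional. -/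
theorem formal_first_order_unique {p : K} (hp : ∀ m : ℕ, 1 ≤ m → p ^ m ≠ 1)
    {A D : K⟦X⟧} (hAD : coeff 0 A = coeff 0 D) (hA : coeff 0 A ≠ 0) {V U : K⟦X⟧}
    (hV : D * rescale p V = A * V) (hU : D * rescale p U = A * U) :
    C (coeff 0 U) * V = C (coeff 0 V) * U := by
  rw [← sub_eq_zero]
  set F := C (coeff 0 U) * V - C (coeff 0 V) * U with hF
  have hF0 : coeff 0 F = 0 := by
    simp only [hF, map_sub, coeff_C_mul]
    ring
  have hFe : D * rescale p F = A * F := by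
    have hC (a : K) : rescale p (C a) = C a := by
      ext n
      rw [coeff_rescale, coeff_C]
      split_ifs with h <;> simp [h]
    simp only [hF, map_sub, map_mul, hC]
    linear_combination C (coeff 0 U) * hV - C (coeff 0 V) * hU
  ext m
  rw [map_zero]
  induction m using Nat.strong_induction_on with
  | _ m ih =>
    rcases Nat.eq_zero_or_pos m with rfl | hm
    · exact hF0
    · have h := congrArg (coeff m) hFe
      rw [coeff_mul, coeff_mul, Finset.Nat.sum_antidiagonal_eq_sum_range_succ_mk,
        Finset.Nat.sum_antidiagonal_eq_sum_range_succ_mk, Finset.sum_range_succ',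
        Finset.sum_range_succ', Finset.sum_eq_zero, Finset.sum_eq_zero] at h
      · simp only [Nat.sub_zero, coeff_rescale, zero_add, ← hAD] at h
        have h2 : coeff 0 A * (p ^ m - 1) * coeff m F = 0 := by linear_combination h
        exact (mul_eq_zero.1 h2).resolve_left (mul_ne_zero hA (sub_ne_zero.2 (hp m hm)))
      · intro i hi
        rw [ih _ (by lia), mul_zero]
      · intro i hi
        rw [coeff_rescale, ih _ (by lia), mul_zero, mul_zero]

/-- The quantum Wronskian of `g` and its reflection `g(-z)` with a shift by `p ^ k`. -/
def qWronskian (p : K) (g : K⟦X⟧) (k : ℕ) : K⟦X⟧ :=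
  rescale (p ^ k) g * rescale (-1) g - (-1) ^ k * rescale (-(p ^ k)) g * g

theorem qWronskian_zero (p : K) (g : K⟦X⟧) : qWronskian p g 0 = 0 := by
  simp [qWronskian, mul_comm]

theorem qWronskian_reflect (p : K) (g : K⟦X⟧) (k : ℕ) :
    rescale (-1) (qWronskian p g k) = -(-1) ^ k * qWronskian p g k := by
  simp only [qWronskian, map_sub, map_mul, rescale_rescale, map_pow, map_neg, map_one]
  simp only [mul_neg, mul_one, neg_neg, rescale_one, RingHom.id_apply]
  have : ((-1 : K⟦X⟧) ^ k) * (-1) ^ k = 1 := by rw [← mul_pow]; simp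
  linear_combination (-(rescale (-(p ^ k)) g * g)) * this

theorem qWronskian_rec {p : K} {g A D T : K⟦X⟧}
    (hD : rescale (-1) D = D) (hA : rescale (-1) A = A) (hT : rescale (-1) T = -T)
    (hg : rescale p D * rescale (p ^ 2) g = rescale p T * rescale p g + rescale p A * g) (k : ℕ) :
    rescale (p ^ (k + 1)) D * qWronskian p g (k + 2)
      = rescale (p ^ (k + 1)) T * qWronskian p g (k + 1)
        + rescale (p ^ (k + 1)) A * qWronskian p g k := by
  have h1 := congrArg (rescale (p ^ k)) hg
  have h2 := congrArg (rescale (-1)) h1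
  simp only [map_add, map_mul, rescale_rescale] at h1 h2
  have hneg (a : K) (f : K⟦X⟧) : rescale (a * -1) f = rescale a (rescale (-1) f) := by
    rw [rescale_rescale, mul_comm]
  rw [hneg _ D, hneg _ A, hneg _ T, hD, hA, hT] at h2
  simp only [qWronskian]
  rw [show p ^ (k + 1) = p * p ^ k by ring, show p ^ (k + 2) = p ^ 2 * p ^ k by ring]
  simp only [mul_neg, mul_one, map_neg] at h2
  linear_combination rescale (-1) g * h1 - (-1) ^ k * g * h2

theorem qWronskian_one_first_order {p : K} {g A D T : K⟦X⟧}
    (hD : rescale (-1) D = D) (hA : rescale (-1) A = A) (hT : rescale (-1) T = -T)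
    (hg : rescale p D * rescale (p ^ 2) g = rescale p T * rescale p g + rescale p A * g) :
    rescale p D * rescale p (qWronskian p g 1) = rescale p A * qWronskian p g 1 := by
  have h2 := congrArg (rescale (-1)) hg
  have hneg (a : K) (f : K⟦X⟧) : rescale (a * -1) f = rescale a (rescale (-1) f) := by
    rw [rescale_rescale, mul_comm]
  simp only [map_add, map_mul, rescale_rescale] at h2
  rw [hneg _ D, hneg _ A, hneg _ T, hD, hA, hT] at h2
  simp only [qWronskian, map_sub, map_mul, map_pow, map_neg, map_one, rescale_rescale]
  simp only [mul_neg, mul_one, neg_mul, one_mul, map_neg, ← sq, pow_one] at h2 ⊢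
  linear_combination rescale (-p) g * hg + rescale p g * h2

/-- If all `q`-Wronskians are polynomials of degree at most `2 M`, then `g` is a polynomial of
degree at most `M`. -/
theorem coeff_eq_zero_of_qWronskian [NeZero (2 : K)] {p : K} (hp0 : p ≠ 0)
    (hp : ∀ m : ℕ, 1 ≤ m → p ^ m ≠ 1) {g : K⟦X⟧} {M : ℕ}
    (h : ∀ k n, 2 * M < n → coeff n (qWronskian p g k) = 0) {m : ℕ} (hm : M < m) :
    coeff m g = 0 := by
  have hinj : Function.Injective fun j : ℕ => p ^ (2 * j + 1) := by
    intro i j hij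
    simp only at hij
    wlog hlt : i < j generalizing i j
    · rcases eq_or_lt_of_le (not_lt.1 hlt) with h | h
      · exact h.symm
      · exact (this hij.symm h).symm
    · exfalso
      refine hp (2 * (j - i)) (by lia) (mul_left_cancel₀ (pow_ne_zero (2 * i + 1) hp0) ?_)
      rw [← pow_add, mul_one, hij]
      congr 1
      lia
  let P : Polynomial K := ∑ a ∈ Finset.range (2 * m + 1),
    Polynomial.C ((-1) ^ a * coeff a g * coeff (2 * m - a) g) * Polynomial.X ^ a
  have hP : P = 0 := by
    apply Polynomial.eq_zero_of_infinite_isRoot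
    refine (Set.infinite_range_of_injective hinj).mono ?_
    rintro _ ⟨j, rfl⟩
    have h1 := h (2 * j + 1) (2 * m) (by lia)
    rw [qWronskian, map_sub, Odd.neg_one_pow ⟨j, rfl⟩, neg_one_mul, neg_mul, map_neg,
      sub_neg_eq_add, coeff_mul, coeff_mul, ← Finset.sum_add_distrib,
      Finset.Nat.sum_antidiagonal_eq_sum_range_succ_mk] at h1
    have h2 : 2 * P.eval (p ^ (2 * j + 1)) = 0 := by
      rw [← h1, Polynomial.eval_finsetSum, Finset.mul_sum]
      refine Finset.sum_congr rfl fun a ha => ?_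
      have ha' : a ≤ 2 * m := by simpa [Nat.lt_succ_iff] using ha
      have hs : (-1 : K) ^ (2 * m - a) = (-1) ^ a := by
        rw [neg_one_pow_congr]
        grind
      simp only [Polynomial.eval_mul, Polynomial.eval_C, Polynomial.eval_pow, Polynomial.eval_X,
        coeff_rescale, hs, neg_pow (p ^ (2 * j + 1)) a]
      ring
    exact (mul_eq_zero.1 h2).resolve_left two_ne_zero
  have hc := congrArg (fun P => Polynomial.coeff P m) hP
  simp only [P, Polynomial.finsetSum_coeff, Polynomial.coeff_C_mul, Polynomial.coeff_X_pow] at hc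
  rw [Finset.sum_eq_single m (by intro b _ hb; simp [hb.symm]) (by intro h; simp at h; lia)] at hc
  simpa [two_mul] using hc

end Formal

section Dilate

open Polynomial

variable {K : Type*} [Field K]

/-- The polynomial `P (c z)`. -/
def dilate (c : K) (P : K[X]) : K[X] := P.comp (C c * X)

theorem eval_dilate (c x : K) (P : K[X]) : (dilate c P).eval x = P.eval (c * x) := by
  simp [dilate]

theorem coeff_dilate (c : K) (P : K[X]) (n : ℕ) : (dilate c P).coeff n = P.coeff n * c ^ n :=
  comp_C_mul_X_coeff

theorem coe_dilate (c : K) (P : K[X]) :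
    ((dilate c P : K[X]) : PowerSeries K) = PowerSeries.rescale c (P : PowerSeries K) := by
  ext n
  rw [coeff_coe, coeff_dilate, PowerSeries.coeff_rescale, coeff_coe, mul_comm]

theorem natDegree_dilate_le (c : K) (P : K[X]) : (dilate c P).natDegree ≤ P.natDegree :=
  natDegree_le_iff_coeff_eq_zero.2 fun n hn => by
    rw [coeff_dilate, coeff_eq_zero_of_natDegree_lt hn, zero_mul]

theorem natDegree_dilate {c : K} (hc : c ≠ 0) (P : K[X]) :
    (dilate c P).natDegree = P.natDegree := by
  rw [dilate, natDegree_comp, natDegree_C_mul hc, natDegree_X, mul_one]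

theorem dilate_ne_zero {c : K} (hc : c ≠ 0) {P : K[X]} (hP : P ≠ 0) : dilate c P ≠ 0 := by
  obtain ⟨n, hn⟩ : ∃ n, P.coeff n ≠ 0 := by
    by_contra! h
    exact hP (Polynomial.ext (by simpa using h))
  intro h
  have := congrArg (fun P => P.coeff n) h
  simp [coeff_dilate, hn, hc] at this

/-- A polynomial that is even or odd up to a unit scalar and vanishes at all `ζ i` is divisible by
`∏ (a² X² - r i²)` with `ζ i = r i / a`. -/
theorem dilate_prod_dvd [NeZero (2 : K)] {ι : Type*} [Fintype ι] {a : K} (ha : a ≠ 0) {c : K}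
    (hc : c ≠ 0) {r : ι → K} (hr0 : ∀ i, r i ≠ 0) (hr : Function.Injective fun i => r i ^ 2)
    {P : K[X]} {s : K} (hs : dilate (-1) P = C s * P) (hP : ∀ i, P.eval (r i / a) = 0) :
    dilate a (C c * ∏ i, (X ^ 2 - C (r i ^ 2))) ∣ P := by
  have hd : dilate a (C c * ∏ i, (X ^ 2 - C (r i ^ 2)))
      = C c * ∏ i, (C (a ^ 2) * X ^ 2 - C (r i ^ 2)) := by
    simp [dilate, Polynomial.prod_comp, mul_pow]
  rw [hd, (isUnit_C.2 hc.isUnit).mul_left_dvd]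
  apply Finset.prod_dvd_of_coprime
  · intro i _ j _ hij
    have hne : r j ^ 2 - r i ^ 2 ≠ 0 := sub_ne_zero.2 fun h => hij (hr h).symm
    refine ⟨C (r j ^ 2 - r i ^ 2)⁻¹, -C (r j ^ 2 - r i ^ 2)⁻¹, ?_⟩
    have : C (r j ^ 2 - r i ^ 2)⁻¹ * C (r j ^ 2 - r i ^ 2) = (1 : K[X]) := by
      rw [← C_mul, inv_mul_cancel₀ hne, C_1]
    rw [C_sub] at this
    linear_combination this
  · intro i _
    have hζ : r i / a ≠ 0 := div_ne_zero (hr0 i) ha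
    have hfac : (C (a ^ 2) * X ^ 2 - C (r i ^ 2) : K[X])
        = C (a ^ 2) * ((X - C (r i / a)) * (X - C (-(r i / a)))) := by
      have : r i ^ 2 = a ^ 2 * (r i / a) ^ 2 := by field_simp
      rw [this]
      simp only [map_mul, map_pow, map_neg]
      ring
    rw [hfac, (isUnit_C.2 (pow_ne_zero 2 ha).isUnit).mul_left_dvd]
    refine IsCoprime.mul_dvd ?_ (dvd_iff_isRoot.2 (hP i)) (dvd_iff_isRoot.2 ?_)
    · apply isCoprime_X_sub_C_of_isUnit_sub
      rw [sub_neg_eq_add, ← two_mul]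
      exact (mul_ne_zero two_ne_zero hζ).isUnit
    · have h := congrArg (eval (r i / a)) hs
      rw [eval_dilate, eval_mul, hP i, mul_zero, neg_one_mul] at h
      exact h

end Dilate

section Baxter

open Polynomial

variable {K : Type*} [Field K]

/-- Data of a polynomial Baxter equation `T(z) G(z) = D(z) G(pz) - A(z) G(z/p)` whose coefficients
satisfy a discrete solvability condition along each of the strings `r n, r n / p, …, r n / p ^ σ n`
of zeros of `D w`. -/
structure BaxterData {ι : Type*} [Fintype ι] (p : K) (σ : ι → ℕ) (r : ι → K)
    (A D T w : K[X]) : Prop where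
  p_ne_zero : p ≠ 0
  p_pow : ∀ m : ℕ, 1 ≤ m → p ^ m ≠ 1
  r_ne_zero : ∀ n, r n ≠ 0
  r_inj : Function.Injective fun n => r n ^ 2
  D_eq : ∃ c : K, c ≠ 0 ∧ D = C c * ∏ n, (X ^ 2 - C (r n ^ 2))
  A_even : dilate (-1) A = A
  T_odd : dilate (-1) T = -T
  coeff_zero : A.coeff 0 = D.coeff 0
  A_degree : A.natDegree ≤ D.natDegree
  T_degree : T.natDegree ≤ D.natDegree
  w_ne_zero : w.coeff 0 ≠ 0
  w_shift : dilate p (D * w) = A * w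
  w_root : ∀ n i, i < σ n → (D * w).eval (r n / p ^ i) = 0
  solvable : ∀ n (f : ℕ → K),
    (∀ i, 1 ≤ i → i ≤ σ n → D.eval (r n / p ^ i) * f (i - 1)
      = T.eval (r n / p ^ i) * f i + A.eval (r n / p ^ i) * f (i + 1)) →
    T.eval (r n) * f 0 + A.eval (r n) * f 1 = 0

namespace BaxterData

variable {ι : Type*} [Fintype ι] {p : K} {σ : ι → ℕ} {r : ι → K} {A D T w : K[X]}

theorem D_even (h : BaxterData p σ r A D T w) : dilate (-1) D = D := by
  obtain ⟨c, -, hD⟩ := h.D_eq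
  simp [hD, dilate, Polynomial.prod_comp]

theorem D_coeff_zero (h : BaxterData p σ r A D T w) : D.coeff 0 ≠ 0 := by
  obtain ⟨c, hc, hD⟩ := h.D_eq
  rw [hD, coeff_zero_eq_eval_zero]
  simp [eval_prod, Finset.prod_eq_zero_iff, h.r_ne_zero, hc]

theorem T_coeff_zero [NeZero (2 : K)] (h : BaxterData p σ r A D T w) : T.coeff 0 = 0 := by
  have h1 := congrArg (fun P => P.coeff 0) h.T_odd
  simp only [coeff_dilate, pow_zero, mul_one, coeff_neg] at h1
  have h2 : (2 : K) * T.coeff 0 = 0 := by linear_combination h1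
  exact (mul_eq_zero.1 h2).resolve_left two_ne_zero

/-- One step of the fusion recursion stays polynomial. -/
theorem fusion_step_dvd [NeZero (2 : K)] (h : BaxterData p σ r A D T w) {y : ℕ → K[X]} {k : ℕ}
    (hrec : ∀ j < k, dilate (p ^ (j + 1)) D * y (j + 2)
      = dilate (p ^ (j + 1)) T * y (j + 1) + dilate (p ^ (j + 1)) A * y j)
    (hy0 : y 0 = 0) (hy1 : ∀ n i, i < σ n → (y 1).eval (r n / p ^ (i + 1)) = 0)
    (hpar : ∀ j ≤ k + 1, dilate (-1) (y j) = -(-1) ^ j * y j) :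
    dilate (p ^ (k + 1)) D ∣
      dilate (p ^ (k + 1)) T * y (k + 1) + dilate (p ^ (k + 1)) A * y k := by
  have hp0 := h.p_ne_zero
  obtain ⟨c, hc, hD⟩ := h.D_eq
  have hcomm (P : K[X]) : dilate (-1) (dilate (p ^ (k + 1)) P)
      = dilate (p ^ (k + 1)) (dilate (-1) P) := by
    ext n
    simp only [coeff_dilate]
    ring
  have hmul (P R : K[X]) : dilate (-1) (P * R) = dilate (-1) P * dilate (-1) R := mul_comp ..
  have hneg (P : K[X]) : dilate (p ^ (k + 1)) (-P) = -dilate (p ^ (k + 1)) P := neg_comp ..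
  conv_lhs => rw [hD]
  refine dilate_prod_dvd (pow_ne_zero _ hp0) hc h.r_ne_zero h.r_inj (s := -(-1) ^ k) ?_
    fun n => ?_
  · rw [show ∀ P R : K[X], dilate (-1) (P + R) = dilate (-1) P + dilate (-1) R from
        fun P R => add_comp .., hmul, hmul, hcomm, hcomm, h.T_odd, h.A_even, hneg,
      hpar (k + 1) le_rfl, hpar k (by lia)]
    simp only [map_neg, map_pow, map_one]
    ring
  · set ζ := r n / p ^ (k + 1) with hζ
    have hpt (i : ℕ) (hi : i ≤ k) : p ^ (k - i + 1) * ζ = r n / p ^ i := by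
      rw [hζ, eq_div_iff (pow_ne_zero _ hp0)]
      field_simp
      rw [mul_right_comm, ← pow_add, mul_comm, show k - i + 1 + i = k + 1 by lia]
    have hsol := h.solvable n (fun i => (y (k + 1 - i)).eval ζ) (by
      intro i hi1 hiσ
      rcases lt_trichotomy i (k + 1) with hik | rfl | hik
      · obtain ⟨j, rfl⟩ : ∃ j, k = i + j := ⟨k - i, by lia⟩
        have h1 := congrArg (eval ζ) (hrec j (by lia))
        have h2 := hpt i (by lia)
        rw [show i + j - i + 1 = j + 1 by lia] at h2
        simp only [eval_mul, eval_add, eval_dilate, h2] at h1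
        rw [show i + j + 1 - (i - 1) = j + 2 by lia, show i + j + 1 - i = j + 1 by lia,
          show i + j + 1 - (i + 1) = j by lia, h1]
      · rw [show k + 1 - (k + 1 - 1) = 1 by lia, show k + 1 - (k + 1) = 0 by lia,
          show k + 1 - (k + 1 + 1) = 0 by lia, hy0, hζ, hy1 n k (by lia)]
        simp
      · rw [show k + 1 - (i - 1) = 0 by lia, show k + 1 - i = 0 by lia,
          show k + 1 - (i + 1) = 0 by lia, hy0]
        simp)
    have h0 := hpt 0 (Nat.zero_le _)
    simp only [Nat.sub_zero, pow_zero, div_one] at h0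
    simpa [eval_dilate, h0] using hsol

/-- A Baxter equation satisfying the discrete solvability condition has a polynomial solution. -/
theorem exists_solution [NeZero (2 : K)] (h : BaxterData p σ r A D T w) {M : ℕ}
    (hM : (D * w).natDegree ≤ 2 * M) :
    ∃ G : K[X], G.natDegree ≤ M ∧ G.coeff 0 = 1 ∧
      dilate p D * dilate (p ^ 2) G = dilate p T * dilate p G + dilate p A * G ∧
      C ((D * w).coeff 0) * (dilate p G * dilate (-1) G + dilate (-p) G * G)
        = C 2 * dilate p (D * w) ∧
      C ((D * w).coeff 0) * (dilate (p ^ 2) G * dilate (-1) G - dilate (-(p ^ 2)) G * G)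
        = C 2 * (dilate p T * dilate p w) := by
  have hp0 := h.p_ne_zero
  have hD0 := h.D_coeff_zero
  set Ω := D * w with hΩ
  have hΩ0 : Ω.coeff 0 ≠ 0 := by
    rw [hΩ, mul_coeff_zero]
    exact mul_ne_zero hD0 h.w_ne_zero
  obtain ⟨g, hg0, hg⟩ := exists_formal_baxter_solution (A := (dilate p A : K[X]))
    (D := (dilate p D : K[X])) (T := (dilate p T : K[X])) h.p_pow
    (by rw [coeff_coe, coeff_coe, coeff_dilate, coeff_dilate, h.coeff_zero])
    (by rwa [coeff_coe, coeff_dilate, h.coeff_zero, pow_zero, mul_one])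
    (by rw [coeff_coe, coeff_dilate, h.T_coeff_zero, zero_mul])
  have hDe : PowerSeries.rescale (-1) (D : PowerSeries K) = D := by rw [← coe_dilate, h.D_even]
  have hAe : PowerSeries.rescale (-1) (A : PowerSeries K) = A := by rw [← coe_dilate, h.A_even]
  have hTo : PowerSeries.rescale (-1) (T : PowerSeries K) = -T := by
    rw [← coe_dilate, h.T_odd, Polynomial.coe_neg]
  have hg' := hg
  simp only [coe_dilate] at hg'
  have hV0 : PowerSeries.coeff 0 (qWronskian p g 1) = 2 := by
    have h0 (a : K) : PowerSeries.constantCoeff (PowerSeries.rescale a g) = 1 := by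
      rw [← PowerSeries.coeff_zero_eq_constantCoeff_apply, PowerSeries.coeff_rescale, hg0]
      simp
    have h1 : PowerSeries.constantCoeff g = 1 := by simpa using hg0
    simp [qWronskian, h0, h1, one_add_one_eq_two]
  have hW1 : PowerSeries.C (Ω.coeff 0) * qWronskian p g 1
      = PowerSeries.C 2 * ((dilate p Ω : K[X]) : PowerSeries K) := by
    have h1 := formal_first_order_unique h.p_pow
      (A := (dilate p A : K[X])) (D := (dilate p D : K[X])) (V := qWronskian p g 1)
      (U := (dilate p Ω : K[X]))
      (by rw [coeff_coe, coeff_coe, coeff_dilate, coeff_dilate, h.coeff_zero])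
      (by rwa [coeff_coe, coeff_dilate, h.coeff_zero, pow_zero, mul_one])
      (by simpa only [coe_dilate] using qWronskian_one_first_order hDe hAe hTo hg')
      (by
        rw [← coe_dilate, ← Polynomial.coe_mul, ← Polynomial.coe_mul]
        congr 1
        have h2 : dilate p (D * w) = dilate p D * dilate p w := mul_comp ..
        have h3 : dilate p (A * w) = dilate p A * dilate p w := mul_comp ..
        rw [hΩ, h.w_shift, h3, ← h.w_shift, h2]
        ring)
    rw [hV0, coeff_coe, coeff_dilate, pow_zero, mul_one] at h1
    exact h1
  have hrec := qWronskian_rec hDe hAe hTo hg'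
  have hpoly (k : ℕ) : ∃ P : K[X], (P : PowerSeries K) = qWronskian p g k ∧
      P.natDegree ≤ 2 * M := by
    induction k using Nat.strong_induction_on with
    | _ k ih =>
      match k, ih with
      | 0, _ => exact ⟨0, by simp [qWronskian_zero], by simp⟩
      | 1, _ =>
        refine ⟨C (2 / Ω.coeff 0) * dilate p Ω, ?_, ?_⟩
        · have hC : PowerSeries.C (Ω.coeff 0)⁻¹ * PowerSeries.C (Ω.coeff 0) = 1 := by
            rw [← map_mul, inv_mul_cancel₀ hΩ0, map_one]
          rw [Polynomial.coe_mul, coe_C, div_eq_inv_mul, map_mul]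
          linear_combination (-PowerSeries.C (Ω.coeff 0)⁻¹) * hW1 + qWronskian p g 1 * hC
        · exact (natDegree_C_mul_le _ _).trans ((natDegree_dilate_le _ _).trans hM)
      | k + 2, ih =>
        choose! y hy hyd using ih
        have hDk : dilate (p ^ (k + 1)) D ≠ 0 :=
          dilate_ne_zero (pow_ne_zero _ hp0) (by rintro rfl; simp at hD0)
        obtain ⟨P, hP⟩ := h.fusion_step_dvd (y := y) (k := k)
          (fun j hj => by
            rw [← Polynomial.coe_inj]
            simp only [Polynomial.coe_add, Polynomial.coe_mul, coe_dilate]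
            rw [hy _ (by lia), hy _ (by lia), hy _ (by lia), hrec])
          (by rw [← Polynomial.coe_inj, hy _ (by lia), qWronskian_zero, Polynomial.coe_zero])
          (fun n i hi => by
            have h1 : C (Ω.coeff 0) * y 1 = C 2 * dilate p Ω := by
              rw [← Polynomial.coe_inj, Polynomial.coe_mul, Polynomial.coe_mul, hy _ (by lia),
                coe_C, coe_C, hW1]
            have h2 := congrArg (eval (r n / p ^ (i + 1))) h1
            rw [eval_mul, eval_mul, eval_dilate, show p * (r n / p ^ (i + 1)) = r n / p ^ i by
              field_simp
              ring, h.w_root n i hi, mul_zero, eval_C] at h2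
            exact (mul_eq_zero.1 h2).resolve_left hΩ0)
          (fun j hj => by
            rw [← Polynomial.coe_inj, coe_dilate, Polynomial.coe_mul, hy _ (by lia),
              qWronskian_reflect]
            simp)
        refine ⟨P, ?_, ?_⟩
        · have h1 := congrArg (fun P : K[X] => (P : PowerSeries K)) hP
          simp only [Polynomial.coe_add, Polynomial.coe_mul] at h1
          rw [hy _ (by lia), hy _ (by lia)] at h1
          simp only [coe_dilate] at h1
          rw [← hrec] at h1
          refine (mul_left_cancel₀ ?_ h1).symm
          rw [← coe_dilate]
          exact fun h0 => hDk (by rwa [← Polynomial.coe_zero, Polynomial.coe_inj] at h0)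
        · rcases eq_or_ne P 0 with rfl | hP0
          · simp
          · have h1 := congrArg natDegree hP
            rw [natDegree_mul hDk hP0, natDegree_dilate (pow_ne_zero _ hp0)] at h1
            have h2 : (dilate (p ^ (k + 1)) T * y (k + 1)
                + dilate (p ^ (k + 1)) A * y k).natDegree ≤ D.natDegree + 2 * M := by
              refine natDegree_add_le_of_degree_le ?_ ?_
              · exact natDegree_mul_le_of_le ((natDegree_dilate_le _ _).trans h.T_degree)
                  (hyd _ (by lia))
              · exact natDegree_mul_le_of_le ((natDegree_dilate_le _ _).trans h.A_degree)
                  (hyd _ (by lia))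
            lia
  have hgc {m : ℕ} (hm : M < m) : PowerSeries.coeff m g = 0 :=
    coeff_eq_zero_of_qWronskian hp0 h.p_pow (fun k n hn => by
      obtain ⟨P, hP, hPd⟩ := hpoly k
      rw [← hP, coeff_coe, coeff_eq_zero_of_natDegree_lt (by lia)]) hm
  obtain ⟨G, rfl⟩ : ∃ G : K[X], (G : PowerSeries K) = g := by
    refine ⟨PowerSeries.trunc (M + 1) g, ?_⟩
    ext m
    rw [coeff_coe, PowerSeries.coeff_trunc]
    split_ifs with hm
    · rfl
    · exact (hgc (by lia)).symm
  have hW1' : C (Ω.coeff 0) * (dilate p G * dilate (-1) G + dilate (-p) G * G)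
      = C 2 * dilate p Ω := by
    rw [← Polynomial.coe_inj]
    simp only [Polynomial.coe_mul, coe_C, Polynomial.coe_add]
    rw [← hW1, qWronskian]
    simp only [coe_dilate, pow_one]
    ring
  refine ⟨G, natDegree_le_iff_coeff_eq_zero.2 fun m hm => by
    rw [← coeff_coe]; exact hgc hm, by rwa [coeff_coe] at hg0, ?_, hW1', ?_⟩
  · rw [← Polynomial.coe_inj]
    simpa only [Polynomial.coe_mul, Polynomial.coe_add, coe_dilate] using hg'
  · have hDk : dilate p D ≠ 0 := dilate_ne_zero hp0 (by rintro rfl; simp at hD0)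
    refine mul_left_cancel₀ hDk ?_
    have h2 : dilate p Ω = dilate p D * dilate p w := mul_comp ..
    have h3 : dilate p D * (dilate (p ^ 2) G * dilate (-1) G - dilate (-(p ^ 2)) G * G)
        = dilate p T * (dilate p G * dilate (-1) G + dilate (-p) G * G) := by
      have h4 := hrec 0
      rw [qWronskian_zero] at h4
      rw [← Polynomial.coe_inj]
      simp only [qWronskian, zero_add, pow_one, mul_zero, add_zero] at h4
      simp only [Polynomial.coe_mul, Polynomial.coe_add, Polynomial.coe_sub, coe_dilate]
      linear_combination h4
    rw [h2] at hW1'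
    linear_combination C (Ω.coeff 0) * h3 + dilate p T * hW1'

end BaxterData

end Baxter

section Tridiagonal

variable {K : Type*} [Field K] {s : ℕ} {a d t : ℕ → K}

theorem tridiagonal_sum {i : ℕ} (hi : i ≤ s) {x y z : K} (hy : i = s → y = 0) (hz : i = 0 → z = 0)
    (φ : ℕ → K) :
    ∑ k : Fin (s + 1), (if i = (k : ℕ) then x else if (k : ℕ) = i + 1 then y
      else if i = (k : ℕ) + 1 then z else 0) * φ k = x * φ i + y * φ (i + 1) + z * φ (i - 1) := by
  rw [Fin.sum_univ_eq_sum_range (fun k => (if i = k then x else if k = i + 1 then y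
      else if i = k + 1 then z else 0) * φ k) (s + 1)]
  have hsplit : ∀ k ∈ Finset.range (s + 1), (if i = k then x else if k = i + 1 then y
      else if i = k + 1 then z else 0) * φ k = (if i = k then x * φ k else 0)
        + (if i + 1 = k then y * φ k else 0) + (if i - 1 = k then z * φ k else 0) := by
    intro k _
    rcases Nat.eq_zero_or_pos i with rfl | h0
    · rw [hz rfl]
      grind
    · grind
  rw [Finset.sum_congr rfl hsplit, Finset.sum_add_distrib, Finset.sum_add_distrib,
    Finset.sum_ite_eq, Finset.sum_ite_eq, Finset.sum_ite_eq, if_pos (by simp; lia),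
    if_pos (c := i - 1 ∈ _) (by simp; lia)]
  rcases eq_or_lt_of_le hi with h | h
  · simp [hy h]
  · rw [if_pos (by simp; lia)]

/-- A solution of the downward three-term recursion is determined by its last value. -/
theorem tridiagonal_eq_zero (has : a s = 0) (hd : ∀ i, 1 ≤ i → i ≤ s → d i ≠ 0) {φ : ℕ → K}
    (hφ : ∀ i, 1 ≤ i → i ≤ s → d i * φ (i - 1) = t i * φ i + a i * φ (i + 1)) (h0 : φ s = 0) :
    ∀ i ≤ s, φ i = 0 := by
  have key : ∀ k ≤ s, φ (s - k) = 0 := by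
    intro k
    induction k using Nat.strong_induction_on with
    | _ k ih =>
      intro hk
      match k, ih with
      | 0, _ => exact h0
      | k + 1, ih =>
        have h1 := hφ (s - k) (by lia) (by lia)
        have h2 : a (s - k) * φ (s - k + 1) = 0 := by
          rcases Nat.eq_zero_or_pos k with rfl | hk0
          · simp [has]
          · rw [show s - k + 1 = s - (k - 1) by lia, ih (k - 1) (by lia) (by lia), mul_zero]
        rw [ih k (by lia) (by lia), h2, mul_zero, add_zero] at h1
        rw [show s - (k + 1) = s - k - 1 by lia]
        exact (mul_eq_zero.1 h1).resolve_left (hd _ (by lia) (by lia))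
  intro i hi
  have := key (s - i) (by lia)
  rwa [show s - (s - i) = i by lia] at this

/-- If a tridiagonal matrix is singular with nonzero subdiagonal, the first row of the associated
linear system follows from the other ones. -/
theorem tridiagonal_first_row (hs : 1 ≤ s) (has : a s = 0) (hd0 : d 0 = 0)
    (hd : ∀ i, 1 ≤ i → i ≤ s → d i ≠ 0)
    (hdet : (Matrix.of fun h k : Fin (s + 1) => if (h : ℕ) = k then t h
      else if (k : ℕ) = h + 1 then a h else if (h : ℕ) = k + 1 then -d h else 0).det = 0)
    {φ : ℕ → K} (hφ : ∀ i, 1 ≤ i → i ≤ s → d i * φ (i - 1) = t i * φ i + a i * φ (i + 1)) :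
    t 0 * φ 0 + a 0 * φ 1 = 0 := by
  obtain ⟨v, hv0, hv⟩ := Matrix.exists_mulVec_eq_zero_iff.2 hdet
  let ψ : ℕ → K := fun k => if h : k < s + 1 then v ⟨k, h⟩ else 0
  have hψv (k : Fin (s + 1)) : ψ k = v k := by simp only [ψ]; rw [dif_pos k.2]
  have hrow (i : ℕ) (hi : i ≤ s) : t i * ψ i + a i * ψ (i + 1) + -d i * ψ (i - 1) = 0 := by
    rw [← tridiagonal_sum hi (by rintro rfl; exact has) (by rintro rfl; simp [hd0])]
    have h1 := congrFun hv ⟨i, by lia⟩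
    simp only [Matrix.mulVec, dotProduct, Matrix.of_apply, Pi.zero_apply] at h1
    simpa only [hψv] using h1
  have hψs : ψ s ≠ 0 := by
    intro h0
    apply hv0
    ext k
    rw [← hψv, tridiagonal_eq_zero (t := t) has hd (fun i _ hi => by
      linear_combination -hrow i hi) h0 k (by lia)]
    rfl
  have hχ := tridiagonal_eq_zero (t := t) (φ := fun i => ψ s * φ i - φ s * ψ i) has hd
    (fun i hi1 hi => by linear_combination ψ s * hφ i hi1 hi + φ s * hrow i hi) (by ring)
  have h0 := hχ 0 (by lia)
  have h1 := hχ 1 hs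
  have hr := hrow 0 (by lia)
  simp only [hd0, zero_add] at h0 h1 hr
  refine (mul_eq_zero.1 (?_ : ψ s * (t 0 * φ 0 + a 0 * φ 1) = 0)).resolve_left hψs
  linear_combination t 0 * h0 + a 0 * h1 + φ s * hr

end Tridiagonal

section SinhPoly

open Polynomial

/-- The polynomial in `z = exp λ` equal to `2 z sinh (λ - x)`. -/
def sinhPoly (x : ℂ) : ℂ[X] :=
  Polynomial.C (Complex.exp (-x)) * (X ^ 2 - Polynomial.C (Complex.exp x ^ 2))

theorem eval_sinhPoly (x lam : ℂ) :
    (sinhPoly x).eval (Complex.exp lam) = 2 * Complex.exp lam * Complex.sinh (lam - x) := by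
  simp only [sinhPoly, eval_mul, eval_C, eval_sub, eval_pow, eval_X, Complex.sinh, Complex.exp_sub,
    Complex.exp_neg, neg_sub]
  have := Complex.exp_ne_zero x
  have := Complex.exp_ne_zero lam
  field_simp

theorem dilate_sinhPoly (η x : ℂ) :
    dilate (Complex.exp η) (sinhPoly x) = Polynomial.C (Complex.exp η) * sinhPoly (x - η) := by
  have h1 : Complex.exp (-(x - η)) = Complex.exp (-x) * Complex.exp η := by
    rw [← Complex.exp_add]; ring_nf
  have h2 : Complex.exp x = Complex.exp (x - η) * Complex.exp η := by
    rw [← Complex.exp_add]; ring_nf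
  simp only [sinhPoly, dilate, mul_comp, C_comp, sub_comp, pow_comp, X_comp, h1]
  rw [h2]
  simp only [map_mul, map_pow]
  ring

theorem dilate_neg_one_sinhPoly (x : ℂ) : dilate (-1) (sinhPoly x) = sinhPoly x := by
  simp [sinhPoly, dilate]

theorem natDegree_sinhPoly (x : ℂ) : (sinhPoly x).natDegree = 2 := by
  rw [sinhPoly, natDegree_C_mul (Complex.exp_ne_zero _), natDegree_X_pow_sub_C]

theorem sinhPoly_ne_zero (x : ℂ) : sinhPoly x ≠ 0 := by
  intro h
  have := natDegree_sinhPoly x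
  simp [h] at this

theorem coeff_zero_sinhPoly (x : ℂ) : (sinhPoly x).coeff 0 = -Complex.exp x := by
  have := Complex.exp_ne_zero x
  rw [coeff_zero_eq_eval_zero]
  simp only [sinhPoly, eval_mul, eval_C, eval_sub, eval_pow, eval_X, Complex.exp_neg]
  field_simp
  ring

theorem coeff_two_sinhPoly (x : ℂ) : (sinhPoly x).coeff 2 = Complex.exp (-x) := by
  simp [sinhPoly, coeff_X_pow, -map_pow]

theorem coeff_prod_sinhPoly {ι : Type*} (S : Finset ι) (x : ι → ℂ) :
    (∏ i ∈ S, sinhPoly (x i)).coeff (2 * S.card) * (∏ i ∈ S, sinhPoly (x i)).coeff 0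
      = (-1) ^ S.card := by
  rw [mul_comm 2, coeff_prod_of_natDegree_le _ _ _ fun i _ => (natDegree_sinhPoly _).le,
    coeff_zero_prod, ← Finset.prod_mul_distrib, ← Finset.prod_const]
  refine Finset.prod_congr rfl fun i _ => ?_
  rw [coeff_zero_sinhPoly, coeff_two_sinhPoly, mul_neg, ← Complex.exp_add, neg_add_cancel,
    Complex.exp_zero]

theorem sinh_eq_zero_imp {x : ℂ} (h : Complex.sinh x = 0) :
    ∃ k : ℤ, x = k * ((Real.pi : ℂ) * Complex.I) := by
  rw [Complex.sinh, div_eq_zero_iff, or_iff_left two_ne_zero, sub_eq_zero,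
    Complex.exp_eq_exp_iff_exists_int] at h
  obtain ⟨k, hk⟩ := h
  exact ⟨k, by linear_combination hk / 2⟩

/-- A polynomial of degree `M` with constant term `1` gives, in the variable `exp λ`, a product of
`M` double-period hyperbolic sines. -/
theorem exists_prod_sinh_half {G : ℂ[X]} {M : ℕ} (hG : G.natDegree = M) (hG0 : G.coeff 0 = 1) :
    ∃ (μ : Fin M → ℂ) (κ : ℂ), κ ^ 2 * G.coeff M * (-4) ^ M = 1 ∧
      ∀ lam : ℂ, ∏ j, Complex.sinh ((lam - μ j) / 2)
        = κ * Complex.exp (-(M * lam / 2)) * G.eval (Complex.exp lam) := by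
  obtain ⟨r, hr⟩ : ∃ r : Fin M → ℂ,
      G = Polynomial.C G.leadingCoeff * ∏ j, (X - Polynomial.C (r j)) := by
    have hs := IsAlgClosed.splits G
    have hc := hs.natDegree_eq_card_roots
    have hp := hs.eq_prod_roots
    rw [hG] at hc
    obtain ⟨l, hl⟩ := Quot.exists_rep G.roots
    change (l : Multiset ℂ) = G.roots at hl
    rw [← hl] at hc hp
    rw [Multiset.coe_card] at hc
    subst hc
    refine ⟨fun j => l[j], ?_⟩
    refine hp.trans ?_
    rw [Multiset.map_coe, Multiset.prod_coe, ← Fin.prod_univ_fun_getElem]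
    rfl
  set g := G.leadingCoeff with hg
  have hgM : G.coeff M = g := by rw [hg, leadingCoeff, hG]
  have h1 : g * ((-1) ^ M * ∏ j, r j) = 1 := by
    have h2 := hG0
    rw [hr, coeff_zero_eq_eval_zero] at h2
    simpa [eval_prod, Finset.prod_neg] using h2
  have hr0 (j) : r j ≠ 0 := by
    intro h
    rw [Finset.prod_eq_zero (Finset.mem_univ j) h] at h1
    simp at h1
  have hg0 : g ≠ 0 := left_ne_zero_of_mul_eq_one h1
  refine ⟨fun j => Complex.log (r j), (∏ j, (Complex.exp (-Complex.log (r j) / 2) / 2)) / g, ?_, ?_⟩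
  · have h3 : (∏ j, (Complex.exp (-Complex.log (r j) / 2) / 2)) ^ 2 * ∏ j, r j = (1 / 4) ^ M := by
      rw [← Finset.prod_pow, ← Finset.prod_mul_distrib]
      conv_rhs => rw [← Fintype.card_fin M, ← Finset.card_univ, ← Finset.prod_const]
      refine Finset.prod_congr rfl fun j _ => ?_
      rw [div_pow, ← Complex.exp_nat_mul]
      have h4 : Complex.exp ((2 : ℕ) * (-Complex.log (r j) / 2)) = (r j)⁻¹ := by
        rw [← Complex.exp_log (hr0 j), ← Complex.exp_neg, Complex.exp_log (hr0 j)]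
        push_cast
        ring_nf
      rw [h4]
      have := hr0 j
      field_simp
      norm_num
    rw [hgM, div_pow]
    have h5 : ((-1 : ℂ) ^ M * ∏ j, r j) = g⁻¹ := eq_inv_of_mul_eq_one_right h1
    set P := (∏ j, (Complex.exp (-Complex.log (r j) / 2) / 2)) ^ 2
    have h6 : P * g⁻¹ = (-1) ^ M * (1 / 4) ^ M := by
      rw [← h5]; linear_combination (-1) ^ M * h3
    calc P / g ^ 2 * g * (-4) ^ M = P * g⁻¹ * (-4) ^ M := by field_simp
      _ = 1 := by rw [h6, ← mul_pow, ← mul_pow]; norm_num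
  · intro lam
    rw [hr]
    simp only [eval_mul, eval_C, eval_prod, eval_sub, eval_X]
    have h3 : Complex.exp (-(M * lam / 2)) = ∏ _j : Fin M, Complex.exp (-(lam / 2)) := by
      rw [Finset.prod_const, Finset.card_univ, Fintype.card_fin, ← Complex.exp_nat_mul]
      ring_nf
    rw [h3]
    have h4 : ∀ P E R : ℂ, P / g * E * (g * R) = P * E * R := by
      intros; field_simp
    rw [h4, ← Finset.prod_mul_distrib, ← Finset.prod_mul_distrib]
    refine Finset.prod_congr rfl fun j _ => ?_
    nth_rewrite 3 [← Complex.exp_log (hr0 j)]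
    rw [Complex.sinh]
    generalize Complex.log (r j) = m
    rw [div_mul_eq_mul_div, div_mul_eq_mul_div, mul_sub, ← Complex.exp_add, ← Complex.exp_add,
      ← Complex.exp_add]
    ring_nf

end SinhPoly

section Chain

open Polynomial

theorem prod_Icc_one_eq_prod_range {M : Type*} [CommMonoid M] (f : ℕ → M) (m : ℕ) :
    ∏ h ∈ Finset.Icc 1 m, f h = ∏ h ∈ Finset.range m, f (h + 1) := by
  induction m with
  | zero => simp
  | succ m ih => rw [Finset.prod_Icc_succ_top (by lia), ih, Finset.prod_range_succ]

variable {N : ℕ} {η : ℂ} {σ : Fin N → ℕ} {ξ : Fin N → ℂ}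

theorem xik_succ (n : Fin N) (k : ℕ) : xik η σ ξ n (k + 1) = xik η σ ξ n k - η := by
  simp only [xik]
  push_cast
  ring

theorem exp_xik (n : Fin N) (k : ℕ) :
    Complex.exp (xik η σ ξ n k) = Complex.exp (xik η σ ξ n 0) / Complex.exp η ^ k := by
  rw [← Complex.exp_nat_mul, ← Complex.exp_sub]
  simp only [xik]
  congr 1
  push_cast
  ring

theorem afun_eq (lam : ℂ) : afun η σ ξ lam = ∏ n, Complex.sinh (lam - xik η σ ξ n (σ n)) :=
  Finset.prod_congr rfl fun n _ => by simp only [xik]; congr 1; ring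

theorem dfun_eq (lam : ℂ) : dfun η σ ξ lam = ∏ n, Complex.sinh (lam - xik η σ ξ n 0) :=
  Finset.prod_congr rfl fun n _ => by simp only [xik]; congr 1; push_cast; ring

theorem exp_pow_ne_one (hη : ∀ r : ℚ, η ≠ (r : ℂ) * ((Real.pi : ℂ) * Complex.I)) (m : ℕ)
    (hm : 1 ≤ m) : Complex.exp η ^ m ≠ 1 := by
  rw [← Complex.exp_nat_mul, Ne, Complex.exp_eq_one_iff]
  rintro ⟨k, hk⟩
  have hm' : (m : ℂ) ≠ 0 := by exact_mod_cast (by lia : m ≠ 0)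
  refine hη (2 * k / m) ?_
  push_cast
  rw [div_mul_eq_mul_div, eq_div_iff hm']
  linear_combination hk

theorem sinh_xik_sub_ne_zero (hη : ∀ r : ℚ, η ≠ (r : ℂ) * ((Real.pi : ℂ) * Complex.I))
    (hC : CondC η σ ξ) {n m : Fin N} {i j : ℕ} (hi : i ≤ σ n) (hj : j ≤ σ m)
    (h : n = m → i ≠ j) : Complex.sinh (xik η σ ξ n i - xik η σ ξ m j) ≠ 0 := by
  intro h0
  obtain ⟨k, hk⟩ := sinh_eq_zero_imp h0
  rcases eq_or_ne n m with rfl | hnm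
  · have hij : (j : ℂ) - i ≠ 0 := sub_ne_zero.2 fun e => h rfl (by exact_mod_cast e.symm)
    refine hη (k / (j - i)) ?_
    push_cast
    rw [div_mul_eq_mul_div, eq_div_iff hij, ← hk]
    simp only [xik]
    ring
  · have hmem : xik η σ ξ n i ∈ XiSet η σ ξ n ∩ XiSet η σ ξ m :=
      ⟨⟨i, hi, 0, by simp⟩, ⟨j, hj, k, by rw [← hk]; ring⟩⟩
    rw [hC n m hnm] at hmem
    exact hmem

theorem dfun_xik_ne_zero (hη : ∀ r : ℚ, η ≠ (r : ℂ) * ((Real.pi : ℂ) * Complex.I))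
    (hC : CondC η σ ξ) (n : Fin N) {i : ℕ} (hi1 : 1 ≤ i) (hi : i ≤ σ n) :
    dfun η σ ξ (xik η σ ξ n i) ≠ 0 := by
  rw [dfun_eq, Finset.prod_ne_zero_iff]
  exact fun m _ => sinh_xik_sub_ne_zero hη hC hi (Nat.zero_le _) (by lia)

theorem dfun_xik_zero (n : Fin N) : dfun η σ ξ (xik η σ ξ n 0) = 0 := by
  rw [dfun_eq]
  exact Finset.prod_eq_zero (Finset.mem_univ n) (by simp)

theorem afun_xik_last (n : Fin N) : afun η σ ξ (xik η σ ξ n (σ n)) = 0 := by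
  rw [afun_eq]
  exact Finset.prod_eq_zero (Finset.mem_univ n) (by simp)

theorem wfun_xik_last_ne_zero (hη : ∀ r : ℚ, η ≠ (r : ℂ) * ((Real.pi : ℂ) * Complex.I))
    (hC : CondC η σ ξ) (n : Fin N) {ε : ℂ} (hε : ε ≠ 0) :
    wfun η σ ξ ε (xik η σ ξ n (σ n)) ≠ 0 := by
  refine mul_ne_zero (mul_ne_zero (mul_ne_zero two_ne_zero hε)
    (pow_ne_zero _ (div_ne_zero Complex.I_ne_zero two_ne_zero))) ?_
  rw [Finset.prod_ne_zero_iff]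
  intro m _
  rw [Finset.prod_ne_zero_iff]
  intro h hh
  rw [Finset.mem_Icc] at hh
  refine sinh_xik_sub_ne_zero hη hC le_rfl (by lia) ?_
  rintro rfl
  lia

variable (η σ ξ)

/-- The polynomial of `exp λ` attached to `a(λ)`. -/
def aPoly : ℂ[X] :=
  Polynomial.C (Complex.exp ((∑ n, σ n : ℕ) * η / 2)) * ∏ n, sinhPoly (xik η σ ξ n (σ n))

/-- The polynomial of `exp λ` attached to `d(λ)`. -/
def dPoly : ℂ[X] :=
  Polynomial.C (Complex.exp (-((∑ n, σ n : ℕ) * η / 2))) * ∏ n, sinhPoly (xik η σ ξ n 0)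

/-- The polynomial of `exp λ` attached to `w(λ)`. -/
def wPoly : ℂ[X] := ∏ n, ∏ h ∈ Finset.Icc 1 (σ n - 1), sinhPoly (xik η σ ξ n h)

/-- The polynomial of `exp λ` attached to a function of t-form with coefficients `c`. -/
def tPoly (c : Fin N → ℂ) : ℂ[X] :=
  Polynomial.C (2 ^ N) * (X * ∑ j, Polynomial.C (c j) * X ^ (2 * (j : ℕ)))

variable {η σ ξ}

theorem eval_aPoly (lam : ℂ) : (aPoly η σ ξ).eval (Complex.exp lam)
    = Complex.exp ((∑ n, σ n : ℕ) * η / 2) * (2 * Complex.exp lam) ^ N * afun η σ ξ lam := by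
  simp [aPoly, eval_prod, eval_sinhPoly, afun_eq, Finset.prod_mul_distrib, mul_pow, mul_assoc]

theorem eval_dPoly (lam : ℂ) : (dPoly η σ ξ).eval (Complex.exp lam)
    = Complex.exp (-((∑ n, σ n : ℕ) * η / 2)) * (2 * Complex.exp lam) ^ N * dfun η σ ξ lam := by
  simp [dPoly, eval_prod, eval_sinhPoly, dfun_eq, Finset.prod_mul_distrib, mul_pow, mul_assoc]

theorem eval_tPoly {c : Fin N → ℂ} {t : ℂ → ℂ} (ht : ∀ lam : ℂ, t lam
      = Complex.exp (-((N : ℂ) - 1) * lam) * ∑ j, c j * Complex.exp (2 * ((j : ℕ) : ℂ) * lam))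
    (lam : ℂ) :
    (tPoly c).eval (Complex.exp lam) = (2 * Complex.exp lam) ^ N * t lam := by
  have h1 : Complex.exp lam ^ N * Complex.exp (-((N : ℂ) - 1) * lam) = Complex.exp lam := by
    rw [← Complex.exp_nat_mul, ← Complex.exp_add]
    ring_nf
  have h2 : (∑ j, Polynomial.C (c j) * X ^ (2 * (j : ℕ))).eval (Complex.exp lam)
      = ∑ j, c j * Complex.exp (2 * ((j : ℕ) : ℂ) * lam) := by
    rw [eval_finsetSum]
    refine Finset.sum_congr rfl fun j _ => ?_
    rw [eval_mul, eval_C, eval_pow, eval_X, ← Complex.exp_nat_mul]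
    push_cast
    rfl
  rw [tPoly, eval_mul, eval_C, eval_mul, eval_X, h2, ht, mul_pow]
  linear_combination (-(2 ^ N * ∑ j, c j * Complex.exp (2 * ((j : ℕ) : ℂ) * lam))) * h1

theorem eval_wPoly (ε lam : ℂ) :
    2 * ε * (Complex.I / 2) ^ (∑ n, σ n) * (wPoly η σ ξ).eval (Complex.exp lam)
      = (2 * Complex.exp lam) ^ (∑ n, (σ n - 1)) * wfun η σ ξ ε lam := by
  simp only [wPoly, wfun, eval_prod, eval_sinhPoly, Finset.prod_mul_distrib, Finset.prod_const,
    Nat.card_Icc, Nat.add_sub_cancel, Finset.prod_pow_eq_pow_sum]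
  ring

theorem dPoly_mul_wPoly (hσ : ∀ n, 1 ≤ σ n) : dPoly η σ ξ * wPoly η σ ξ
    = Polynomial.C (Complex.exp (-((∑ n, σ n : ℕ) * η / 2)))
      * ∏ n, ∏ h ∈ Finset.range (σ n), sinhPoly (xik η σ ξ n h) := by
  rw [dPoly, wPoly, mul_assoc, ← Finset.prod_mul_distrib]
  congr 1
  refine Finset.prod_congr rfl fun n _ => ?_
  obtain ⟨m, hm⟩ : ∃ m, σ n = m + 1 := ⟨σ n - 1, by have := hσ n; lia⟩
  rw [hm, Finset.prod_range_succ', Nat.add_sub_cancel, prod_Icc_one_eq_prod_range, mul_comm]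

theorem aPoly_mul_wPoly (hσ : ∀ n, 1 ≤ σ n) : aPoly η σ ξ * wPoly η σ ξ
    = Polynomial.C (Complex.exp ((∑ n, σ n : ℕ) * η / 2))
      * ∏ n, ∏ h ∈ Finset.range (σ n), sinhPoly (xik η σ ξ n (h + 1)) := by
  rw [aPoly, wPoly, mul_assoc, ← Finset.prod_mul_distrib]
  congr 1
  refine Finset.prod_congr rfl fun n _ => ?_
  obtain ⟨m, hm⟩ : ∃ m, σ n = m + 1 := ⟨σ n - 1, by have := hσ n; lia⟩
  rw [hm, Finset.prod_range_succ, Nat.add_sub_cancel, prod_Icc_one_eq_prod_range, mul_comm]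

theorem natDegree_C_mul_prod_sinhPoly {c : ℂ} (hc : c ≠ 0) {ι : Type*} (S : Finset ι) (x : ι → ℂ) :
    (Polynomial.C c * ∏ i ∈ S, sinhPoly (x i)).natDegree = 2 * S.card := by
  rw [natDegree_C_mul hc, natDegree_prod _ _ fun i _ => sinhPoly_ne_zero _]
  simp [natDegree_sinhPoly, mul_comm]

theorem prod_prod_range_eq_sigma {R : Type*} [CommMonoid R] (f : Fin N → ℕ → R) :
    ∏ n, ∏ h ∈ Finset.range (σ n), f n h
      = ∏ i ∈ Finset.univ.sigma (fun n => Finset.range (σ n)), f i.1 i.2 :=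
  (Finset.prod_sigma Finset.univ (fun n => Finset.range (σ n)) (fun i => f i.1 i.2)).symm

theorem coeff_top_mul_coeff_zero (hσ : ∀ n, 1 ≤ σ n) :
    (dPoly η σ ξ * wPoly η σ ξ).coeff (2 * ∑ n, σ n) * (dPoly η σ ξ * wPoly η σ ξ).coeff 0
        * Complex.exp η ^ (∑ n, σ n) = (-1) ^ (∑ n, σ n) := by
  have h := coeff_prod_sinhPoly (Finset.univ.sigma (fun n => Finset.range (σ n)))
    (fun i => xik η σ ξ i.1 i.2)
  have hcard : (Finset.univ.sigma (fun n => Finset.range (σ n))).card = ∑ n, σ n := by simp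
  have hexp : Complex.exp (-((∑ n, σ n : ℕ) * η / 2)) ^ 2 * Complex.exp η ^ (∑ n, σ n) = 1 := by
    rw [← Complex.exp_nat_mul, ← Complex.exp_nat_mul, ← Complex.exp_add, Complex.exp_eq_one_iff]
    exact ⟨0, by push_cast; ring⟩
  rw [dPoly_mul_wPoly hσ, prod_prod_range_eq_sigma (fun n h => sinhPoly (xik η σ ξ n h)),
    coeff_C_mul, coeff_C_mul]
  rw [hcard] at h
  linear_combination h + (∏ i ∈ Finset.univ.sigma (fun n => Finset.range (σ n)),
      sinhPoly (xik η σ ξ i.1 i.2)).coeff (2 * ∑ n, σ n)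
    * (∏ i ∈ Finset.univ.sigma (fun n => Finset.range (σ n)),
      sinhPoly (xik η σ ξ i.1 i.2)).coeff 0 * hexp

theorem natDegree_dPoly_mul_wPoly (hσ : ∀ n, 1 ≤ σ n) :
    (dPoly η σ ξ * wPoly η σ ξ).natDegree = 2 * ∑ n, σ n := by
  rw [dPoly_mul_wPoly hσ, prod_prod_range_eq_sigma (fun n h => sinhPoly (xik η σ ξ n h)),
    natDegree_C_mul_prod_sinhPoly (Complex.exp_ne_zero _)
      (Finset.univ.sigma (fun n => Finset.range (σ n))) (fun i => xik η σ ξ i.1 i.2)]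
  simp

theorem baxterData_of_det_eq_zero (hσ : ∀ n, 1 ≤ σ n)
    (hη : ∀ r : ℚ, η ≠ (r : ℂ) * ((Real.pi : ℂ) * Complex.I)) (hC : CondC η σ ξ)
    {c : Fin N → ℂ} {t : ℂ → ℂ} (ht : ∀ lam : ℂ, t lam
      = Complex.exp (-((N : ℂ) - 1) * lam) * ∑ j, c j * Complex.exp (2 * ((j : ℕ) : ℂ) * lam))
    (hdet : ∀ n : Fin N, (Dmat η σ ξ t n).det = 0) :
    BaxterData (Complex.exp η) σ (fun n => Complex.exp (xik η σ ξ n 0)) (aPoly η σ ξ)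
      (dPoly η σ ξ) (tPoly c) (wPoly η σ ξ) where
  p_ne_zero := Complex.exp_ne_zero _
  p_pow := exp_pow_ne_one hη
  r_ne_zero _ := Complex.exp_ne_zero _
  r_inj := by
    intro n m h
    by_contra hnm
    simp only [← Complex.exp_nat_mul] at h
    obtain ⟨k, hk⟩ := Complex.exp_eq_exp_iff_exists_int.1 h
    have hmem : xik η σ ξ n 0 ∈ XiSet η σ ξ n ∩ XiSet η σ ξ m :=
      ⟨⟨0, Nat.zero_le _, 0, by simp⟩, ⟨0, Nat.zero_le _, k, by
        push_cast at hk
        linear_combination hk / 2⟩⟩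
    rw [hC n m hnm] at hmem
    exact hmem
  D_eq := by
    refine ⟨Complex.exp (-((∑ n, σ n : ℕ) * η / 2)) * ∏ n, Complex.exp (-xik η σ ξ n 0),
      mul_ne_zero (Complex.exp_ne_zero _)
        (Finset.prod_ne_zero_iff.2 fun _ _ => Complex.exp_ne_zero _), ?_⟩
    simp only [dPoly, sinhPoly, Finset.prod_mul_distrib, map_mul, map_prod]
    ring
  A_even := by
    have := dilate_neg_one_sinhPoly
    simp only [dilate] at this
    simp [aPoly, dilate, Polynomial.prod_comp, this, -map_neg, -map_one]
  T_odd := by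
    simp [tPoly, dilate, pow_mul]
  coeff_zero := by
    simp only [aPoly, dPoly, coeff_C_mul, coeff_zero_prod, coeff_zero_sinhPoly, Finset.prod_neg,
      ← Complex.exp_sum]
    rw [mul_left_comm, ← Complex.exp_add, mul_left_comm, ← Complex.exp_add]
    congr 2
    simp only [xik, Finset.sum_add_distrib, ← Finset.sum_mul, Finset.sum_sub_distrib,
      ← Finset.sum_div]
    push_cast
    simp
    ring
  A_degree := by
    rw [aPoly, dPoly, natDegree_C_mul_prod_sinhPoly (Complex.exp_ne_zero _),
      natDegree_C_mul_prod_sinhPoly (Complex.exp_ne_zero _)]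
  T_degree := by
    rw [dPoly, natDegree_C_mul_prod_sinhPoly (Complex.exp_ne_zero _), Finset.card_univ,
      Fintype.card_fin, tPoly]
    refine (natDegree_C_mul_le _ _).trans ?_
    rw [Finset.mul_sum]
    refine natDegree_sum_le_of_forall_le _ _ fun j _ => ?_
    rw [mul_left_comm, ← pow_succ']
    exact (natDegree_C_mul_X_pow_le _ _).trans (by have := j.2; lia)
  w_ne_zero := by
    simp only [wPoly, coeff_zero_prod, coeff_zero_sinhPoly]
    exact Finset.prod_ne_zero_iff.2 fun _ _ => Finset.prod_ne_zero_iff.2 fun _ _ =>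
      neg_ne_zero.2 (Complex.exp_ne_zero _)
  w_shift := by
    have hd := dilate_sinhPoly
    simp only [dilate] at hd
    rw [dPoly_mul_wPoly hσ, aPoly_mul_wPoly hσ]
    simp only [dilate, mul_comp, C_comp, Polynomial.prod_comp, hd, Finset.prod_mul_distrib, xik_succ]
    rw [← mul_assoc]
    congr 1
    simp only [Finset.prod_const, Finset.card_range, Finset.prod_pow_eq_pow_sum]
    rw [← map_pow, ← map_mul, ← Complex.exp_nat_mul, ← Complex.exp_add]
    ring_nf
  w_root n i hi := by
    rw [← exp_xik, dPoly_mul_wPoly hσ, eval_mul, eval_prod,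
      Finset.prod_eq_zero (Finset.mem_univ n), mul_zero]
    rw [eval_prod]
    refine Finset.prod_eq_zero (Finset.mem_range.2 hi) ?_
    simp [eval_sinhPoly]
  solvable n f hf := by
    simp only [← exp_xik, eval_aPoly, eval_dPoly, eval_tPoly ht] at hf ⊢
    set κ := Complex.exp ((∑ n, σ n : ℕ) * η / 2) with hκ
    rw [Complex.exp_neg, ← hκ] at hf
    have hκ0 : κ ≠ 0 := Complex.exp_ne_zero _
    have hE (lam : ℂ) : (2 * Complex.exp lam) ^ N ≠ 0 :=
      pow_ne_zero _ (mul_ne_zero two_ne_zero (Complex.exp_ne_zero _))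
    have h := tridiagonal_first_row (a := fun i => afun η σ ξ (xik η σ ξ n i))
      (d := fun i => dfun η σ ξ (xik η σ ξ n i)) (t := fun i => t (xik η σ ξ n i))
      (φ := fun i => κ ^ i * f i) (hσ n) (afun_xik_last n) (dfun_xik_zero n)
      (fun i hi1 hi => dfun_xik_ne_zero hη hC n hi1 hi) (hdet n) (by
        intro i hi1 hi
        have h1 := hf i hi1 hi
        obtain ⟨j, rfl⟩ : ∃ j, i = j + 1 := ⟨i - 1, by lia⟩
        refine mul_left_cancel₀ (hE (xik η σ ξ n (j + 1))) ?_
        simp only [Nat.add_sub_cancel] at h1 ⊢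
        field_simp at h1 ⊢
        linear_combination κ ^ j * h1)
    simp only [pow_zero, one_mul, pow_one] at h
    linear_combination (2 * Complex.exp (xik η σ ξ n 0)) ^ N * h

end Chain

section Main

open Polynomial

theorem coeff_sq_of_wronskian {p : ℂ} (hp : p ≠ 0) {G Ω : ℂ[X]} {M : ℕ} (hG : G.natDegree ≤ M)
    (hW : Polynomial.C (Ω.coeff 0) * (dilate p G * dilate (-1) G + dilate (-p) G * G)
      = Polynomial.C 2 * dilate p Ω) :
    Ω.coeff 0 * G.coeff M ^ 2 * (-1) ^ M = p ^ M * Ω.coeff (2 * M) := by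
  have h := congrArg (fun P => P.coeff (M + M)) hW
  simp only [coeff_C_mul, coeff_add, coeff_dilate] at h
  rw [coeff_mul_add_eq_of_natDegree_le ((natDegree_dilate_le _ _).trans hG)
      ((natDegree_dilate_le _ _).trans hG),
    coeff_mul_add_eq_of_natDegree_le ((natDegree_dilate_le _ _).trans hG) hG] at h
  simp only [coeff_dilate] at h
  rw [← two_mul, neg_pow p, mul_comm 2 M, pow_mul'] at h
  rw [mul_comm 2 M]
  refine mul_left_cancel₀ (pow_ne_zero M hp) ?_
  linear_combination h / 2

variable {N : ℕ} {η : ℂ} {σ : Fin N → ℕ} {ξ : Fin N → ℂ}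

theorem exists_baxter_function (hσ : ∀ n, 1 ≤ σ n)
    (hη : ∀ r : ℚ, η ≠ (r : ℂ) * ((Real.pi : ℂ) * Complex.I)) (hC : CondC η σ ξ)
    {t : ℂ → ℂ} (ht : tForm N t) (hdet : ∀ n : Fin N, (Dmat η σ ξ t n).det = 0) :
    ∃ ε : ℂ, (ε = 1 ∨ ε = -1) ∧ ∃ (Q : ℂ → ℂ) (μ : Fin (∑ n, σ n) → ℂ),
      (∀ lam : ℂ, Q lam = ∏ j, Complex.sinh ((lam - μ j) / 2)) ∧
      (∀ lam : ℂ, t lam * wfun η σ ξ ε lam =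
        Q (lam + η) * Q (lam + (Real.pi : ℂ) * Complex.I - η)
          - Q (lam + η + (Real.pi : ℂ) * Complex.I) * Q (lam - η)) ∧
      (∀ lam : ℂ,
        Q lam * Q (lam + (Real.pi : ℂ) * Complex.I - η)
          + Q (lam + (Real.pi : ℂ) * Complex.I) * Q (lam - η)
        = dfun η σ ξ lam * wfun η σ ξ ε lam) ∧
      (∀ lam : ℂ, dfun η σ ξ lam * Q (lam + η)
        = t lam * Q lam + afun η σ ξ lam * Q (lam - η)) ∧
      (∀ lam : ℂ, dfun η σ ξ lam * Q (lam + η + (Real.pi : ℂ) * Complex.I)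
        = -(t lam * Q (lam + (Real.pi : ℂ) * Complex.I))
          + afun η σ ξ lam * Q (lam - η + (Real.pi : ℂ) * Complex.I)) := by
  obtain ⟨c, ht⟩ := ht
  have h := baxterData_of_det_eq_zero hσ hη hC ht hdet
  obtain ⟨G, hGdeg, hG0, hTQ, hW, hT⟩ := h.exists_solution (natDegree_dPoly_mul_wPoly hσ).le
  have htop := coeff_sq_of_wronskian h.p_ne_zero hGdeg hW
  have hlead := coeff_top_mul_coeff_zero (η := η) (ξ := ξ) hσ
  set M := ∑ n, σ n with hM
  set p := Complex.exp η with hp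
  set Ω₀ := (dPoly η σ ξ * wPoly η σ ξ).coeff 0 with hΩ₀
  have hsq : (Ω₀ * G.coeff M) ^ 2 = 1 := by
    have h1 : ((-1 : ℂ) ^ M) ≠ 0 := pow_ne_zero _ (neg_ne_zero.2 one_ne_zero)
    refine mul_right_cancel₀ h1 ?_
    linear_combination Ω₀ * htop + hlead
  have hΩg : Ω₀ * G.coeff M ≠ 0 := fun h0 => by simp [h0] at hsq
  have hΩ : Ω₀ ≠ 0 := left_ne_zero_of_mul hΩg
  have hg : G.coeff M ≠ 0 := right_ne_zero_of_mul hΩg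
  obtain ⟨μ, K, hK, hQ⟩ := exists_prod_sinh_half
    (le_antisymm hGdeg (le_natDegree_of_ne_zero hg)) hG0
  set ε : ℂ := Ω₀ * G.coeff M with hε
  have hεK : ε = K ^ 2 * (-4) ^ M / Ω₀ := by
    rw [eq_div_iff hΩ]
    refine mul_right_cancel₀ hg ?_
    linear_combination hsq - hK
  set κ := Complex.exp ((M : ℕ) * η / 2) with hκ
  have hκ0 : κ ≠ 0 := Complex.exp_ne_zero _
  obtain ⟨E, hE⟩ : ∃ E : ℂ → ℂ, E = fun lam => Complex.exp (-(M * lam / 2)) := ⟨_, rfl⟩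
  have hE2 (lam : ℂ) : E lam ^ 2 * Complex.exp lam ^ M = 1 := by
    rw [hE, ← Complex.exp_nat_mul, ← Complex.exp_nat_mul, ← Complex.exp_add,
      Complex.exp_eq_one_iff]
    exact ⟨0, by push_cast; ring⟩
  have hEp (lam : ℂ) : E (lam + η) = E lam / κ := by
    rw [hE, hκ, ← Complex.exp_sub]
    ring_nf
  have hEm (lam : ℂ) : E (lam - η) = E lam * κ := by
    rw [hE, hκ, ← Complex.exp_add]
    ring_nf
  have hEpi (lam : ℂ) : E (lam + (Real.pi : ℂ) * Complex.I) = E lam * (-Complex.I) ^ M := by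
    rw [hE, ← Complex.exp_neg_pi_div_two_mul_I, ← Complex.exp_nat_mul, ← Complex.exp_add]
    ring_nf
  have hxpi (lam : ℂ) : Complex.exp (lam + (Real.pi : ℂ) * Complex.I) = -Complex.exp lam :=
    Complex.exp_add_pi_mul_I lam
  have hx (lam : ℂ) : Complex.exp lam = p * Complex.exp (lam - η) := by
    rw [hp, ← Complex.exp_add]
    ring_nf
  have hxp (lam : ℂ) : Complex.exp (lam + η) = p ^ 2 * Complex.exp (lam - η) := by
    rw [hp, ← Complex.exp_nat_mul, ← Complex.exp_add]
    congr 1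
    push_cast
    ring
  obtain ⟨Q, hQdef⟩ : ∃ Q : ℂ → ℂ, ∀ lam, Q lam = ∏ j, Complex.sinh ((lam - μ j) / 2) :=
    ⟨_, fun _ => rfl⟩
  have hQ (lam : ℂ) : Q lam = K * E lam * G.eval (Complex.exp lam) := by rw [hQdef, hQ, hE]
  have hQpi (lam : ℂ) : Q (lam + (Real.pi : ℂ) * Complex.I)
      = K * (E lam * (-Complex.I) ^ M) * G.eval (-Complex.exp lam) := by rw [hQ, hEpi, hxpi]
  have hord (lam : ℂ) : lam + (Real.pi : ℂ) * Complex.I - η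
      = lam - η + (Real.pi : ℂ) * Complex.I := by ring
  have hscal : K ^ 2 * (-Complex.I) ^ M * 2 ^ M = Ω₀ * ε * (Complex.I / 2) ^ M := by
    rw [hεK, mul_div_cancel₀ _ hΩ, mul_assoc, mul_assoc, ← mul_pow, ← mul_pow]
    congr 2
    ring
  have hw (lam : ℂ) : 2 * ε * (Complex.I / 2) ^ M * (2 * Complex.exp lam) ^ N
        * (wPoly η σ ξ).eval (Complex.exp lam)
      = (2 * Complex.exp lam) ^ M * wfun η σ ξ ε lam := by
    have hsum : N + ∑ n, (σ n - 1) = M := by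
      have : ∑ n : Fin N, (1 + (σ n - 1)) = M :=
        Finset.sum_congr rfl fun n _ => by have := hσ n; lia
      rw [Finset.sum_add_distrib] at this
      simpa using this
    rw [← hsum, pow_add (2 * Complex.exp lam), mul_assoc ((2 * Complex.exp lam) ^ N),
      ← eval_wPoly, hsum]
    ring
  have hD (lam : ℂ) := eval_dPoly (η := η) (σ := σ) (ξ := ξ) lam
  simp only [Complex.exp_neg, ← hM, ← hκ] at hD
  have hA (lam : ℂ) := eval_aPoly (η := η) (σ := σ) (ξ := ξ) lam
  simp only [← hM, ← hκ] at hA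
  have hx0 (lam : ℂ) : (2 * Complex.exp lam) ^ N ≠ 0 :=
    pow_ne_zero _ (mul_ne_zero two_ne_zero (Complex.exp_ne_zero _))
  have hxM (lam : ℂ) : (2 * Complex.exp lam) ^ M ≠ 0 :=
    pow_ne_zero _ (mul_ne_zero two_ne_zero (Complex.exp_ne_zero _))
  have heval {P R : ℂ[X]} (hPR : P = R) (z : ℂ) : P.eval z = R.eval z := by rw [hPR]
  have hDe := h.D_even
  have hAe := h.A_even
  have hTo := h.T_odd
  refine ⟨ε, by simpa using hsq, Q, μ, hQdef, fun lam => ?_, fun lam => ?_,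
    fun lam => ?_, fun lam => ?_⟩
  · have h1 := heval hT (Complex.exp (lam - η))
    simp only [eval_mul, eval_C, eval_sub, eval_dilate, ← hx, neg_mul, ← hxp, one_mul] at h1
    rw [eval_tPoly ht] at h1
    rw [hord, hQpi, hQpi, hQ, hQ, hEp, hEm]
    refine mul_left_cancel₀ (hxM lam) ?_
    calc (2 * Complex.exp lam) ^ M * (t lam * wfun η σ ξ ε lam)
        = K ^ 2 * (-Complex.I) ^ M * 2 ^ M * (E lam ^ 2 * Complex.exp lam ^ M)
          * (G.eval (Complex.exp (lam + η)) * G.eval (-Complex.exp (lam - η))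
            - G.eval (-Complex.exp (lam + η)) * G.eval (Complex.exp (lam - η))) := by
          rw [hE2, hscal]
          linear_combination -(t lam) * hw lam - ε * (Complex.I / 2) ^ M * h1
      _ = _ := by
          rw [mul_pow]
          field_simp
  · have h1 := heval hW (Complex.exp (lam - η))
    simp only [eval_mul, eval_C, eval_add, eval_dilate, ← hx, neg_mul, one_mul] at h1
    rw [hD] at h1
    rw [hord, hQpi, hQpi, hQ, hQ, hEm]
    refine mul_left_cancel₀ (hxM lam) ?_
    refine Eq.symm ?_
    calc (2 * Complex.exp lam) ^ M * (dfun η σ ξ lam * wfun η σ ξ ε lam)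
        = K ^ 2 * (-Complex.I) ^ M * 2 ^ M * (E lam ^ 2 * Complex.exp lam ^ M) * κ
          * (G.eval (Complex.exp lam) * G.eval (-Complex.exp (lam - η))
            + G.eval (-Complex.exp lam) * G.eval (Complex.exp (lam - η))) := by
          rw [hE2, hscal]
          linear_combination -(dfun η σ ξ lam) * hw lam - ε * (Complex.I / 2) ^ M * κ * h1
            - 2 * ε * (Complex.I / 2) ^ M * (2 * Complex.exp lam) ^ N * dfun η σ ξ lam
              * (wPoly η σ ξ).eval (Complex.exp lam) * inv_mul_cancel₀ hκ0
      _ = _ := by ring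
  · have h1 := heval hTQ (Complex.exp (lam - η))
    simp only [eval_mul, eval_add, eval_dilate, ← hx, ← hxp] at h1
    rw [hD, hA, eval_tPoly ht] at h1
    rw [hQ, hQ, hQ, hEp, hEm]
    refine mul_left_cancel₀ (hx0 lam) ?_
    linear_combination K * E lam * h1
  · have h1 := heval hTQ (-Complex.exp (lam - η))
    have h2 := heval hDe (Complex.exp lam)
    have h3 := heval hAe (Complex.exp lam)
    have h4 := heval hTo (Complex.exp lam)
    simp only [eval_neg, eval_dilate, neg_mul, one_mul] at h2 h3 h4
    simp only [eval_mul, eval_add, eval_dilate, mul_neg, ← hx, ← hxp] at h1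
    rw [h2, h3, h4, hD, hA, eval_tPoly ht] at h1
    rw [hQpi, hQpi, hQpi, hEp, hEm]
    refine mul_left_cancel₀ (hx0 lam) ?_
    linear_combination K * E lam * (-Complex.I) ^ M * h1

end Main

theorem stmt_13 {N : ℕ} (hN : 1 ≤ N) (σ : Fin N → ℕ) (hσ : ∀ n, 1 ≤ σ n)
    (η : ℂ) (hη : ∀ r : ℚ, η ≠ (r : ℂ) * ((Real.pi : ℂ) * Complex.I))
    (ξ : Fin N → ℂ) (hC : CondC η σ ξ)
    (t : ℂ → ℂ) (ht : tForm N t)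
    (hdet : ∀ n : Fin N, (Dmat η σ ξ t n).det = 0) :
    ∃ ε : ℂ, (ε = 1 ∨ ε = -1) ∧
    ∃ (Q : ℂ → ℂ) (μ : Fin (∑ n, σ n) → ℂ),
      (∀ lam : ℂ, Q lam = ∏ j, Complex.sinh ((lam - μ j) / 2)) ∧
      (∀ lam : ℂ, t lam * wfun η σ ξ ε lam =
        Q (lam + η) * Q (lam + (Real.pi : ℂ) * Complex.I - η)
          - Q (lam + η + (Real.pi : ℂ) * Complex.I) * Q (lam - η)) ∧
      (∀ lam : ℂ,
        Q lam * Q (lam + (Real.pi : ℂ) * Complex.I - η)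
          + Q (lam + (Real.pi : ℂ) * Complex.I) * Q (lam - η)
        = dfun η σ ξ lam * wfun η σ ξ ε lam) ∧
      (∀ n : Fin N,
        (∃ c₁ c₂ : ℂ, ¬(c₁ = 0 ∧ c₂ = 0) ∧ ∀ h : Fin (σ n + 1),
          c₁ * Q (xik η σ ξ n (h : ℕ))
            + c₂ * ((-1 : ℂ) ^ (h : ℕ) * Q (xik η σ ξ n (h : ℕ) + (Real.pi : ℂ) * Complex.I)) = 0) ∧
        ¬((∀ h : Fin (σ n + 1), Q (xik η σ ξ n (h : ℕ)) = 0) ∧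
          (∀ h : Fin (σ n + 1),
            (-1 : ℂ) ^ (h : ℕ) * Q (xik η σ ξ n (h : ℕ) + (Real.pi : ℂ) * Complex.I) = 0))) := by
  obtain ⟨ε, hε, Q, μ, hQ, hTQ₂, hW, hTQ, hTQpi⟩ := exists_baxter_function hσ hη hC ht hdet
  refine ⟨ε, hε, Q, μ, hQ, hTQ₂, hW, fun n => ?_⟩
  have hε0 : ε ≠ 0 := by
    rcases hε with rfl | rfl <;> simp
  have hne : ¬(Q (xik η σ ξ n (σ n)) = 0
      ∧ Q (xik η σ ξ n (σ n) + (Real.pi : ℂ) * Complex.I) = 0) := by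
    rintro ⟨h1, h2⟩
    have h := hW (xik η σ ξ n (σ n))
    rw [h1, h2, zero_mul, zero_mul, add_zero] at h
    exact mul_ne_zero (dfun_xik_ne_zero hη hC n (hσ n) le_rfl)
      (wfun_xik_last_ne_zero hη hC n hε0) h.symm
  have hsign : ((-1 : ℂ) ^ σ n) ≠ 0 := pow_ne_zero _ (neg_ne_zero.2 one_ne_zero)
  refine ⟨⟨(-1) ^ σ n * Q (xik η σ ξ n (σ n) + (Real.pi : ℂ) * Complex.I),
    -Q (xik η σ ξ n (σ n)), ?_, fun h => ?_⟩, ?_⟩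
  · rintro ⟨h1, h2⟩
    exact hne ⟨neg_eq_zero.1 h2, (mul_eq_zero.1 h1).resolve_left hsign⟩
  · refine tridiagonal_eq_zero (a := fun i => afun η σ ξ (xik η σ ξ n i))
      (d := fun i => dfun η σ ξ (xik η σ ξ n i)) (t := fun i => t (xik η σ ξ n i))
      (φ := fun i => (-1) ^ σ n * Q (xik η σ ξ n (σ n) + (Real.pi : ℂ) * Complex.I)
        * Q (xik η σ ξ n i) + -Q (xik η σ ξ n (σ n))
        * ((-1) ^ i * Q (xik η σ ξ n i + (Real.pi : ℂ) * Complex.I)))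
      (afun_xik_last n) (fun i hi1 hi => dfun_xik_ne_zero hη hC n hi1 hi) (fun i hi1 _ => ?_)
      (by ring) h (Nat.lt_succ_iff.1 h.2)
    obtain ⟨j, rfl⟩ : ∃ j, i = j + 1 := ⟨i - 1, by lia⟩
    have h1 := hTQ (xik η σ ξ n (j + 1))
    have h2 := hTQpi (xik η σ ξ n (j + 1))
    rw [show xik η σ ξ n (j + 1) + η = xik η σ ξ n j by rw [xik_succ]; ring, ← xik_succ] at h1 h2
    simp only [Nat.add_sub_cancel]
    linear_combination (-1) ^ σ n * Q (xik η σ ξ n (σ n) + (Real.pi : ℂ) * Complex.I) * h1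
      - Q (xik η σ ξ n (σ n)) * (-1) ^ j * h2
  · rintro ⟨h1, h2⟩
    exact hne ⟨by simpa using h1 (Fin.last _),
      (mul_eq_zero.1 (by simpa using h2 (Fin.last _))).resolve_left hsign⟩
end
end

section
/- Let M ∈ ℕ, η ∈ ℂ, and λ_1,…,λ_M ∈ ℂ, and set Q(λ) = ∏_{j=1}^M sinh((λ − λ_j)/2). Then for all λ ∈ ℂ: Q(λ+iπ)·Q(λ−η) + Q(λ)·Q(λ+iπ−η) = (i/2)^M · [ ∏_{j=1}^M ( sinh(λ − λ_j − η/2) − sinh(η/2) ) + ∏_{j=1}^M ( sinh(λ − λ_j − η/2) + sinh(η/2) ) ]. -/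
open Complex Finset

/-- The product-to-sum formula for `sinh a * cosh b`. -/
theorem sinh_mul_cosh_eq (a b : ℂ) :
    Complex.sinh a * Complex.cosh b = (Complex.sinh (a + b) + Complex.sinh (a - b)) / 2 := by
  rw [Complex.sinh_add, Complex.sinh_sub]
  ring

theorem sinh_add_pi_mul_I_div_two (x : ℂ) :
    Complex.sinh ((x + (Real.pi : ℂ) * Complex.I) / 2) = Complex.I * Complex.cosh (x / 2) := by
  rw [show (x + (Real.pi : ℂ) * Complex.I) / 2 = x / 2 + (Real.pi : ℂ) / 2 * Complex.I by ring,
    Complex.sinh_add, Complex.cosh_mul_I, Complex.sinh_mul_I, Complex.cos_pi_div_two,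
    Complex.sin_pi_div_two]
  ring

theorem stmt_14 (M : ℕ) (η : ℂ) (μ : Fin M → ℂ) (Q : ℂ → ℂ)
    (hQ : ∀ lam : ℂ, Q lam = ∏ j, Complex.sinh ((lam - μ j) / 2)) :
    ∀ lam : ℂ,
      Q (lam + (Real.pi : ℂ) * Complex.I) * Q (lam - η)
        + Q lam * Q (lam + (Real.pi : ℂ) * Complex.I - η)
      = (Complex.I / 2) ^ M *
        ((∏ j, (Complex.sinh (lam - μ j - η / 2) - Complex.sinh (η / 2)))
          + ∏ j, (Complex.sinh (lam - μ j - η / 2) + Complex.sinh (η / 2))) := by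
  intro lam
  have hI : (Complex.I / 2) ^ M = ∏ _j : Fin M, Complex.I / 2 := by simp [div_pow]
  simp only [hQ]
  rw [mul_add, hI, ← prod_mul_distrib, ← prod_mul_distrib, ← prod_mul_distrib,
    ← prod_mul_distrib]
  congr 1 <;> refine prod_congr rfl fun j _ => ?_
  · rw [show lam + (Real.pi : ℂ) * Complex.I - μ j
        = (lam - μ j) + (Real.pi : ℂ) * Complex.I by ring, sinh_add_pi_mul_I_div_two,
      mul_assoc, mul_comm (Complex.cosh _), sinh_mul_cosh_eq,
      show (lam - η - μ j) / 2 + (lam - μ j) / 2 = lam - μ j - η / 2 by ring,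
      show (lam - η - μ j) / 2 - (lam - μ j) / 2 = -(η / 2) by ring, Complex.sinh_neg]
    ring
  · rw [show lam + (Real.pi : ℂ) * Complex.I - η - μ j
        = (lam - η - μ j) + (Real.pi : ℂ) * Complex.I by ring, sinh_add_pi_mul_I_div_two,
      mul_left_comm, sinh_mul_cosh_eq,
      show (lam - μ j) / 2 + (lam - η - μ j) / 2 = lam - μ j - η / 2 by ring,
      show (lam - μ j) / 2 - (lam - η - μ j) / 2 = η / 2 by ring]
    ring
end

section
/- Let Q be of form (Q2) with roots λ_1,…,λ_{N_s}, and suppose Q satisfies the Wronskian relation with some ε ∈ {−1, +1}. Then there exists an integer m ∈ ℤ such that ∑_{a=1}^{N_s} λ_a = i·((1−ε)/2 + 2m)·π + ∑_{b=1}^N ∑_{h=0}^{2s_b−1} ξ_b^{(h)} − (N_s/2)·η. -/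
open Complex Finset

noncomputable section

open Filter Topology in
/-- After removing the growth factor `e^x`, `sinh (x + c)` tends to `e^c / 2` at `+∞`. -/
lemma tendsto_exp_neg_mul_sinh_add (c : ℂ) :
    Tendsto (fun x : ℝ => exp (-(x : ℂ)) * sinh ((x : ℂ) + c)) atTop (𝓝 (exp c / 2)) := by
  have h : Tendsto (fun x : ℝ => exp (-(x : ℂ))) atTop (𝓝 0) := by
    have h0 := (continuous_ofReal.tendsto 0).comp Real.tendsto_exp_neg_atTop_nhds_zero
    simpa [Function.comp_def] using h0
  have h2 : Tendsto (fun x : ℝ => exp c / 2 - exp (-(x : ℂ)) * exp (-(x : ℂ)) * (exp (-c) / 2))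
      atTop (𝓝 (exp c / 2 - 0 * 0 * (exp (-c) / 2))) :=
    tendsto_const_nhds.sub ((h.mul h).mul_const _)
  simp only [zero_mul, sub_zero] at h2
  refine h2.congr fun x => ?_
  have h3 : exp (-(x : ℂ)) * exp (x : ℂ) = 1 := by rw [← exp_add]; simp
  rw [sinh, neg_add, exp_add, exp_add]
  linear_combination (-exp c / 2) * h3

open Filter Topology in
/-- Leading behaviour at `+∞` of a product of factors `sinh ((x + c - μ j) / 2)`. -/
lemma tendsto_exp_neg_half_pow_mul_prod_sinh {M : ℕ} (μ : Fin M → ℂ) (c : ℂ) :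
    Tendsto (fun x : ℝ => exp (-((x / 2 : ℝ) : ℂ)) ^ M * ∏ j, sinh (((x : ℂ) + c - μ j) / 2))
      atTop (𝓝 (exp ((M * c - ∑ j, μ j) / 2) / 2 ^ M)) := by
  have h : Tendsto (fun x : ℝ => ∏ j, exp (-((x / 2 : ℝ) : ℂ)) *
      sinh (((x / 2 : ℝ) : ℂ) + (c - μ j) / 2)) atTop (𝓝 (∏ j, exp ((c - μ j) / 2) / 2)) :=
    tendsto_finsetProd _ fun j _ => (tendsto_exp_neg_mul_sinh_add ((c - μ j) / 2)).comp
      (tendsto_id.atTop_div_const (two_pos : (0 : ℝ) < 2))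
  convert h using 2
  · rw [prod_mul_distrib, prod_const, card_univ, Fintype.card_fin]
    congr 1
    refine prod_congr rfl fun j _ => ?_
    congr 1
    push_cast
    ring
  · rw [prod_div_distrib, prod_const, card_univ, Fintype.card_fin, ← exp_sum, ← sum_div]
    simp

/-- The factors of `d` and `w_ε` combine into one product over `0 ≤ h < 2 s_n`. -/
lemma dfun_mul_wfun {N : ℕ} (σ : Fin N → ℕ) (hσ : ∀ n, 1 ≤ σ n) (η : ℂ) (ξ : Fin N → ℂ)
    (ε lam : ℂ) :
    dfun η σ ξ lam * wfun η σ ξ ε lam = 2 * ε * (I / 2) ^ (∑ n, σ n) *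
      ∏ n, ∏ h ∈ range (σ n), sinh (lam - xik η σ ξ n h) := by
  rw [dfun, wfun, mul_left_comm, ← prod_mul_distrib]
  congr 1
  refine prod_congr rfl fun n _ => ?_
  obtain ⟨k, hk⟩ := Nat.exists_eq_add_of_le' (hσ n)
  have h0 : lam - ξ n - ((σ n : ℂ) / 2) * η = lam - xik η σ ξ n 0 := by
    rw [xik]; push_cast; ring
  rw [h0, hk, prod_range_succ', mul_comm, Nat.add_sub_cancel, range_eq_Ico, prod_Ico_add'
    (fun h => sinh (lam - xik η σ ξ n h)) 0 k 1]
  rfl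

open Filter Topology in
/-- Leading behaviour at `+∞` of the right-hand side of the Wronskian relation. -/
lemma tendsto_exp_neg_pow_mul_prod_sinh {N : ℕ} (σ : Fin N → ℕ) (z : Fin N → ℕ → ℂ) :
    Tendsto (fun x : ℝ => exp (-(x : ℂ)) ^ (∑ n, σ n) *
        ∏ n, ∏ h ∈ range (σ n), sinh ((x : ℂ) - z n h))
      atTop (𝓝 (exp (-∑ n, ∑ h ∈ range (σ n), z n h) / 2 ^ (∑ n, σ n))) := by
  have h : Tendsto (fun x : ℝ => ∏ n, ∏ h ∈ range (σ n), exp (-(x : ℂ)) *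
      sinh ((x : ℂ) + -z n h)) atTop (𝓝 (∏ n, ∏ h ∈ range (σ n), exp (-z n h) / 2)) :=
    tendsto_finsetProd _ fun n _ => tendsto_finsetProd _ fun h _ =>
      tendsto_exp_neg_mul_sinh_add (-z n h)
  convert h using 2
  · simp only [prod_mul_distrib, prod_const, card_range, prod_pow_eq_pow_sum, sub_eq_add_neg]
  · simp only [prod_div_distrib, prod_const, card_range, prod_pow_eq_pow_sum, ← exp_sum,
      sum_neg_distrib]

/-- Solve the comparison of leading coefficients for the sum of the roots. -/
lemma exists_int_of_leading_coeff_eq {M : ℕ} {S X η ε : ℂ} (hε : ε = 1 ∨ ε = -1)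
    (h : exp ((M * 0 - S) / 2) / 2 ^ M * (exp ((M * (Real.pi * I - η) - S) / 2) / 2 ^ M) +
        exp ((M * (Real.pi * I) - S) / 2) / 2 ^ M * (exp ((M * -η - S) / 2) / 2 ^ M) =
      2 * ε * (I / 2) ^ M * (exp (-X) / 2 ^ M)) :
    ∃ m : ℤ, S = I * ((1 - ε) / 2 + 2 * (m : ℂ)) * Real.pi + X - ((M : ℂ) / 2) * η := by
  have hI : I ^ M = exp (M * (Real.pi * I / 2)) := by
    rw [exp_nat_mul, mul_div_right_comm, exp_pi_div_two_mul_I]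
  have hε' : ε = exp (-(Real.pi * I * ((1 - ε) / 2))) := by
    rcases hε with rfl | rfl
    · simp
    · norm_num [exp_neg, exp_pi_mul_I]
  have h1 : exp ((M * 0 - S) / 2) * exp ((M * (Real.pi * I - η) - S) / 2) =
      exp (M * (Real.pi * I / 2) - M / 2 * η - S) := by
    rw [← exp_add]; ring_nf
  have h2 : exp ((M * (Real.pi * I) - S) / 2) * exp ((M * -η - S) / 2) =
      exp (M * (Real.pi * I / 2) - M / 2 * η - S) := by
    rw [← exp_add]; ring_nf
  have h3 : exp (M * (Real.pi * I / 2) - M / 2 * η - S) = ε * (I ^ M * exp (-X)) := by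
    rw [div_mul_div_comm, div_mul_div_comm, h1, h2, div_pow] at h
    generalize exp (M * (Real.pi * I / 2) - M / 2 * η - S) = E at h ⊢
    field_simp at h
    linear_combination h / 2
  rw [hI, hε', ← exp_add, ← exp_add, exp_eq_exp_iff_exists_int] at h3
  obtain ⟨n, hn⟩ := h3
  refine ⟨-n, ?_⟩
  push_cast
  linear_combination -hn

theorem stmt_15 {N : ℕ} (hN : 1 ≤ N) (σ : Fin N → ℕ) (hσ : ∀ n, 1 ≤ σ n)
    (η : ℂ) (hη : ∀ r : ℚ, η ≠ (r : ℂ) * ((Real.pi : ℂ) * Complex.I))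
    (ξ : Fin N → ℂ)
    (ε : ℂ) (hε : ε = 1 ∨ ε = -1)
    (Q : ℂ → ℂ) (μ : Fin (∑ n, σ n) → ℂ)
    (hQ : ∀ lam : ℂ, Q lam = ∏ j, Complex.sinh ((lam - μ j) / 2))
    (hWr : ∀ lam : ℂ,
      Q lam * Q (lam + (Real.pi : ℂ) * Complex.I - η)
        + Q (lam + (Real.pi : ℂ) * Complex.I) * Q (lam - η)
      = dfun η σ ξ lam * wfun η σ ξ ε lam) :
    ∃ m : ℤ, ∑ a, μ a =
      Complex.I * ((1 - ε) / 2 + 2 * (m : ℂ)) * (Real.pi : ℂ)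
        + (∑ b, ∑ h ∈ Finset.range (σ b), xik η σ ξ b h)
        - (((∑ n, σ n : ℕ) : ℂ) / 2) * η := by
  have hlim (c : ℂ) := tendsto_exp_neg_half_pow_mul_prod_sinh μ c
  have hL := ((hlim 0).mul (hlim (Real.pi * I - η))).add ((hlim (Real.pi * I)).mul (hlim (-η)))
  have hR := (tendsto_exp_neg_pow_mul_prod_sinh σ (xik η σ ξ)).const_mul
    (2 * ε * (I / 2) ^ (∑ n, σ n))
  refine exists_int_of_leading_coeff_eq hε (tendsto_nhds_unique (hL.congr fun x => ?_) hR)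
  have hx : exp (-(x : ℂ)) = exp (-((x / 2 : ℝ) : ℂ)) * exp (-((x / 2 : ℝ) : ℂ)) := by
    rw [← exp_add]
    congr 1
    push_cast
    ring
  have h := hWr x
  rw [dfun_mul_wfun σ hσ] at h
  simp only [hQ] at h
  rw [hx, mul_pow]
  simp only [add_zero, ← add_sub_assoc, ← sub_eq_add_neg]
  linear_combination (exp (-((x / 2 : ℝ) : ℂ)) ^ (∑ n, σ n) *
    exp (-((x / 2 : ℝ) : ℂ)) ^ (∑ n, σ n)) * h
end
end

section
/- Assume condition (C). Let c ∈ ℂ \ {0}, let μ_1,…,μ_{N_s} ∈ ℂ, and set W(λ) = c·∏_{j=1}^{N_s} sinh(λ − μ_j). Then a(λ)·W(λ) = d(λ)·W(λ+η) for all λ ∈ ℂ if and only if there is a bijection σ from the index set {(n,h) : 1 ≤ n ≤ N, 0 ≤ h ≤ 2s_n−1} onto {1,…,N_s} such that μ_{σ(n,h)} − ξ_n^{(h)} ∈ iπℤ for every pair (n,h). -/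
open Complex Finset

noncomputable section

open Polynomial in
/-- Two products of shifted hyperbolic sines that agree as functions have the same shifts,
modulo `iπ`. -/
lemma map_exp_eq_of_prod_sinh_eq {ι : Type*} [Fintype ι] (x y : ι → ℂ)
    (h : ∀ z : ℂ, ∏ i, Complex.sinh (z - x i) = ∏ i, Complex.sinh (z - y i)) :
    (univ : Finset ι).val.map (fun i => Complex.exp (2 * x i)) =
      (univ : Finset ι).val.map (fun i => Complex.exp (2 * y i)) := by
  have key : ∀ (x : ι → ℂ) (z : ℂ), ∏ i, Complex.sinh (z - x i) =
      (∏ _i : ι, (Complex.exp (-z) / 2)) * ((∏ i, Complex.exp (-x i)) *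
        ∏ i, (Complex.exp (2 * z) - Complex.exp (2 * x i))) := by
    intro x z
    rw [← Finset.prod_mul_distrib, ← Finset.prod_mul_distrib]
    refine Finset.prod_congr rfl fun i _ => ?_
    have h1 : Complex.exp (-z) * Complex.exp z = 1 := by rw [← Complex.exp_add]; simp
    have h2 : Complex.exp (-x i) * Complex.exp (x i) = 1 := by rw [← Complex.exp_add]; simp
    have h3 : Complex.exp (-(z - x i)) = Complex.exp (-z) * Complex.exp (x i) := by
      rw [← Complex.exp_add]; congr 1; ring
    rw [Complex.sinh, h3, sub_eq_add_neg z, Complex.exp_add, two_mul, two_mul, Complex.exp_add,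
      Complex.exp_add]
    linear_combination (-Complex.exp z * Complex.exp (-x i) / 2) * h1 +
      (Complex.exp (-z) * Complex.exp (x i) / 2) * h2
  have hne : ∀ x : ι → ℂ, ∏ i, Complex.exp (-x i) ≠ 0 := fun x =>
    Finset.prod_ne_zero_iff.2 fun i _ => Complex.exp_ne_zero _
  have hpoly : C (∏ i, Complex.exp (-x i)) * ∏ i, (X - C (Complex.exp (2 * x i))) =
      C (∏ i, Complex.exp (-y i)) * ∏ i, (X - C (Complex.exp (2 * y i))) := by
    refine Polynomial.eq_of_infinite_eval_eq _ _ ?_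
    refine Set.Infinite.mono (s := {0}ᶜ) ?_ (Set.finite_singleton (0 : ℂ)).infinite_compl
    intro w hw
    have hz : Complex.exp (2 * (Complex.log w / 2)) = w := by
      rw [mul_div_cancel₀ _ two_ne_zero, Complex.exp_log hw]
    have h1 := h (Complex.log w / 2)
    rw [key, key, hz] at h1
    have h2 := mul_left_cancel₀ (Finset.prod_ne_zero_iff.2 fun i _ =>
      div_ne_zero (Complex.exp_ne_zero _) two_ne_zero) h1
    simpa [eval_prod] using h2
  have hr := congrArg Polynomial.roots hpoly
  rw [roots_C_mul _ (hne x), roots_C_mul _ (hne y)] at hr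
  have hroots : ∀ u : ι → ℂ, (∏ i, (X - C (u i))).roots = univ.val.map u := by
    intro u
    rw [← roots_multiset_prod_X_sub_C (univ.val.map u), Multiset.map_map]
    rfl
  rwa [hroots, hroots] at hr

/-- If `q` has infinite order, the difference of two multisets of nonzero numbers is determined by
its difference with its dilation by `q`. -/
lemma multiset_eq_of_add_map_div_eq {q : ℂ} (hq0 : q ≠ 0) (hq : ∀ k : ℕ, 0 < k → q ^ k ≠ 1)
    {M R : Multiset ℂ} (hM : 0 ∉ M) (hR : 0 ∉ R)
    (h : M + R.map (fun z => z / q) = R + M.map (fun z => z / q)) : M = R := by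
  classical
  have hinj : Function.Injective (fun z : ℂ => z / q) := fun a b hab => by
    simpa [div_left_inj' hq0] using hab
  have hstep : ∀ z, M.count z + R.count (z * q) = R.count z + M.count (z * q) := by
    intro z
    have hcount : ∀ S : Multiset ℂ, (S.map (fun z => z / q)).count z = S.count (z * q) := by
      intro S
      have := Multiset.count_map_eq_count' (fun z : ℂ => z / q) S hinj (z * q)
      rwa [mul_div_cancel_right₀ _ hq0] at this
    have := congrArg (Multiset.count z) h
    rwa [Multiset.count_add, Multiset.count_add, hcount, hcount] at this
  ext z
  rcases eq_or_ne z 0 with rfl | hz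
  · rw [Multiset.count_eq_zero_of_notMem hM, Multiset.count_eq_zero_of_notMem hR]
  have hiter : ∀ k : ℕ, M.count z + R.count (z * q ^ k) = R.count z + M.count (z * q ^ k) := by
    intro k
    induction k with
    | zero => simp [add_comm]
    | succ k ih =>
      have := hstep (z * q ^ k)
      rw [pow_succ, ← mul_assoc]
      omega
  have hpow : Function.Injective (fun k : ℕ => z * q ^ k) := by
    intro j k hjk
    have hjk' : q ^ j = q ^ k := mul_left_cancel₀ hz hjk
    by_contra hne
    wlog hlt : j < k generalizing j k
    · exact this hjk.symm hjk'.symm (Ne.symm hne) (by omega)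
    refine hq (k - j) (by omega) (mul_left_cancel₀ (pow_ne_zero j hq0) ?_)
    rw [← pow_add, Nat.add_sub_cancel' hlt.le, mul_one, hjk']
  obtain ⟨_, ⟨k, rfl⟩, hk⟩ :=
    (Set.infinite_range_of_injective hpow).exists_notMem_finset (M + R).toFinset
  rw [Multiset.mem_toFinset, Multiset.mem_add, not_or] at hk
  have := hiter k
  rw [Multiset.count_eq_zero_of_notMem hk.1, Multiset.count_eq_zero_of_notMem hk.2] at this
  omega

/-- Two families with the same multiset of values differ by a permutation of the index type. -/
lemma exists_perm_of_map_univ_eq {α β : Type*} [Fintype α] {f g : α → β}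
    (h : (univ : Finset α).val.map f = (univ : Finset α).val.map g) :
    ∃ τ : Equiv.Perm α, ∀ a, f (τ a) = g a := by
  classical
  have hcard : ∀ b, Fintype.card {a // g a = b} = Fintype.card {a // f a = b} := by
    intro b
    have hb := congrArg (Multiset.count b) h
    rw [Multiset.count_map, Multiset.count_map] at hb
    simp only [eq_comm (a := b)] at hb
    rw [Fintype.card_subtype, Fintype.card_subtype]
    exact hb.symm
  exact ⟨Equiv.ofFiberEquiv fun b => Fintype.equivOfCardEq (hcard b),
    fun a => Equiv.ofFiberEquiv_map _ a⟩

lemma sinh_sub_int_mul_pi_I (z : ℂ) (k : ℤ) :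
    Complex.sinh (z - k * (Real.pi * Complex.I)) = (-1) ^ k * Complex.sinh z := by
  have hs : Complex.sinh (k * (Real.pi * Complex.I)) = 0 := by
    rw [← mul_assoc, Complex.sinh_mul_I, Complex.sin_int_mul_pi, zero_mul]
  have hcosh : Complex.cosh (k * (Real.pi * Complex.I)) = (-1) ^ k := by
    rw [← mul_assoc, Complex.cosh_mul_I]
    simpa using congrArg Complex.ofReal (Real.cos_int_mul_pi k)
  rw [Complex.sinh_sub, hs, hcosh]
  ring

/-- The string `∏ₙ ∏_{h<2s_n} sinh(λ − ξ_n^{(h)})` solves the first-order difference equation. -/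
lemma afun_mul_prod_sinh_xik {N : ℕ} (η : ℂ) (σ : Fin N → ℕ) (ξ : Fin N → ℂ) (z : ℂ) :
    afun η σ ξ z * ∏ p : (n : Fin N) × Fin (σ n), Complex.sinh (z - xik η σ ξ p.1 (p.2 : ℕ)) =
      dfun η σ ξ z *
        ∏ p : (n : Fin N) × Fin (σ n), Complex.sinh (z + η - xik η σ ξ p.1 (p.2 : ℕ)) := by
  rw [Fintype.prod_sigma, Fintype.prod_sigma, afun, dfun, ← Finset.prod_mul_distrib,
    ← Finset.prod_mul_distrib]
  refine Finset.prod_congr rfl fun n _ => ?_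
  rw [Fin.prod_univ_eq_prod_range (fun h => Complex.sinh (z - xik η σ ξ n h)),
    Fin.prod_univ_eq_prod_range (fun h => Complex.sinh (z + η - xik η σ ξ n h))]
  have h1 : z - ξ n + ((σ n : ℂ) / 2) * η = z - xik η σ ξ n (σ n) := by
    rw [xik]; ring
  have h2 : z - ξ n - ((σ n : ℂ) / 2) * η = z - xik η σ ξ n 0 := by
    rw [xik]; push_cast; ring
  have h3 : ∀ h : ℕ, z + η - xik η σ ξ n h = z - xik η σ ξ n (h + 1) := by
    intro h; rw [xik, xik]; push_cast; ring
  simp only [h1, h2, h3]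
  rw [mul_comm, ← Finset.prod_range_succ (fun h => Complex.sinh (z - xik η σ ξ n h)),
    Finset.prod_range_succ', mul_comm]

/-- A solution `∏ sinh(λ − x_p)` of the first-order difference equation has the roots of its
two sides equal in the variable `exp (2λ)`. -/
lemma map_exp_add_eq_of_afun_mul_eq {N : ℕ} {κ : Type*} [Fintype κ] (η : ℂ) (σ : Fin N → ℕ)
    (ξ : Fin N → ℂ) (x : κ → ℂ)
    (h : ∀ z, afun η σ ξ z * ∏ p, Complex.sinh (z - x p) =
      dfun η σ ξ z * ∏ p, Complex.sinh (z + η - x p)) :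
    (univ : Finset (Fin N)).val.map (fun n => Complex.exp (2 * (ξ n - ((σ n : ℂ) / 2) * η))) +
        (univ : Finset κ).val.map (fun p => Complex.exp (2 * x p)) =
      (univ : Finset (Fin N)).val.map (fun n => Complex.exp (2 * (ξ n + ((σ n : ℂ) / 2) * η))) +
        ((univ : Finset κ).val.map (fun p => Complex.exp (2 * x p))).map
          (fun w => w / Complex.exp (2 * η)) := by
  have hsum : ∀ (u : Fin N → ℂ) (v : κ → ℂ),
      (univ : Finset (Fin N ⊕ κ)).val.map (fun i => Complex.exp (2 * Sum.elim u v i)) =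
        (univ : Finset (Fin N)).val.map (fun n => Complex.exp (2 * u n)) +
          (univ : Finset κ).val.map (fun p => Complex.exp (2 * v p)) := by
    intro u v
    rw [← Finset.univ_disjSum_univ, Finset.val_disjSum, Multiset.disjSum, Multiset.map_add,
      Multiset.map_map, Multiset.map_map]
    rfl
  have := map_exp_eq_of_prod_sinh_eq
    (Sum.elim (fun n => ξ n - ((σ n : ℂ) / 2) * η) x)
    (Sum.elim (fun n => ξ n + ((σ n : ℂ) / 2) * η) (fun p => x p - η)) ?_
  · rw [hsum, hsum] at this
    rw [this, Multiset.map_map]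
    congr 2
    funext p
    rw [Function.comp_apply, mul_sub, Complex.exp_sub]
  · intro z
    have hz := h z
    rw [afun, dfun] at hz
    rw [Fintype.prod_sum_type, Fintype.prod_sum_type]
    simp only [Sum.elim_inl, Sum.elim_inr]
    have h1 : ∀ n, z - (ξ n - ((σ n : ℂ) / 2) * η) = z - ξ n + ((σ n : ℂ) / 2) * η := fun n => by
      ring
    have h2 : ∀ n, z - (ξ n + ((σ n : ℂ) / 2) * η) = z - ξ n - ((σ n : ℂ) / 2) * η := fun n => by
      ring
    have h3 : ∀ p, z - (x p - η) = z + η - x p := fun p => by ring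
    simp only [h1, h2, h3]
    exact hz

theorem stmt_16 {N : ℕ} (hN : 1 ≤ N) (σ : Fin N → ℕ) (hσ : ∀ n, 1 ≤ σ n)
    (η : ℂ) (hη : ∀ r : ℚ, η ≠ (r : ℂ) * ((Real.pi : ℂ) * Complex.I))
    (ξ : Fin N → ℂ) (hC : CondC η σ ξ)
    (c : ℂ) (hc : c ≠ 0) (μ : Fin (∑ n, σ n) → ℂ) (W : ℂ → ℂ)
    (hW : ∀ lam : ℂ, W lam = c * ∏ j, Complex.sinh (lam - μ j)) :
    (∀ lam : ℂ, afun η σ ξ lam * W lam = dfun η σ ξ lam * W (lam + η)) ↔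
      ∃ e : ((n : Fin N) × Fin (σ n)) ≃ Fin (∑ n, σ n),
        ∀ p : (n : Fin N) × Fin (σ n), ∃ k : ℤ,
          μ (e p) - xik η σ ξ p.1 (p.2 : ℕ) = (k : ℂ) * ((Real.pi : ℂ) * Complex.I) := by
  constructor
  · intro h
    let E : ((n : Fin N) × Fin (σ n)) ≃ Fin (∑ n, σ n) := finSigmaFinEquiv
    have hμ := map_exp_add_eq_of_afun_mul_eq η σ ξ (fun p => μ (E p)) (by
      intro z
      have hz := h z
      rw [hW, hW, mul_left_comm, mul_left_comm _ c] at hz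
      rw [E.prod_comp (fun j => Complex.sinh (z - μ j)),
        E.prod_comp (fun j => Complex.sinh (z + η - μ j))]
      exact mul_left_cancel₀ hc hz)
    have hξ := map_exp_add_eq_of_afun_mul_eq η σ ξ
      (fun p : (n : Fin N) × Fin (σ n) => xik η σ ξ p.1 (p.2 : ℕ)) (afun_mul_prod_sinh_xik η σ ξ)
    have hzero : ∀ x : (n : Fin N) × Fin (σ n) → ℂ,
        (0 : ℂ) ∉ (univ : Finset ((n : Fin N) × Fin (σ n))).val.map
          (fun p => Complex.exp (2 * x p)) := by
      intro x hx
      obtain ⟨p, -, hp⟩ := Multiset.mem_map.1 hx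
      exact Complex.exp_ne_zero _ hp
    have hq : ∀ k : ℕ, 0 < k → Complex.exp (2 * η) ^ k ≠ 1 := by
      intro k hk hone
      rw [← Complex.exp_nat_mul, Complex.exp_eq_one_iff] at hone
      obtain ⟨m, hm⟩ := hone
      refine hη (m / k) ?_
      have hk' : (k : ℂ) ≠ 0 := by exact_mod_cast hk.ne'
      push_cast
      field_simp
      linear_combination hm / 2
    have hMR := multiset_eq_of_add_map_div_eq (Complex.exp_ne_zero _) hq
      (hzero fun p => xik η σ ξ p.1 (p.2 : ℕ)) (hzero fun p => μ (E p)) (by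
        have h1 := congrArg₂ (· + ·) hξ hμ.symm
        refine add_left_cancel (a := univ.val.map
          (fun n => Complex.exp (2 * (ξ n - ((σ n : ℂ) / 2) * η))) + univ.val.map
          (fun n => Complex.exp (2 * (ξ n + ((σ n : ℂ) / 2) * η)))) ?_
        change _ + _ + (_ + _) = _ + _ + (_ + _) at h1
        rw [add_add_add_comm, h1]
        abel)
    obtain ⟨τ, hτ⟩ := exists_perm_of_map_univ_eq hMR.symm
    refine ⟨τ.trans E, fun p => ?_⟩
    obtain ⟨k, hk⟩ := Complex.exp_eq_exp_iff_exists_int.1 (hτ p)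
    refine ⟨k, ?_⟩
    rw [Equiv.trans_apply]
    linear_combination hk / 2
  · rintro ⟨e, he⟩ z
    choose k hk using he
    have hprod : ∀ w, ∏ j, Complex.sinh (w - μ j) =
        (∏ p, (-1 : ℂ) ^ k p) * ∏ p : (n : Fin N) × Fin (σ n),
          Complex.sinh (w - xik η σ ξ p.1 (p.2 : ℕ)) := by
      intro w
      rw [← e.prod_comp, ← Finset.prod_mul_distrib]
      refine Finset.prod_congr rfl fun p _ => ?_
      rw [← sinh_sub_int_mul_pi_I, ← hk p]
      congr 1
      ring
    rw [hW, hW, hprod, hprod]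
    linear_combination (c * ∏ p, (-1 : ℂ) ^ k p) * afun_mul_prod_sinh_xik η σ ξ z
end
end

section
/- Let t : ℂ → ℂ be of t-form and let Q(λ) = e^{−N_s λ/2}·∑_{j=0}^{N_s} c_j e^{jλ} with c_0,…,c_{N_s} ∈ ℂ. Define F_Q(λ) = t(λ)Q(λ) + a(λ)Q(λ−η) − d(λ)Q(λ+η). Then: (i) F_Q(λ) can be written as e^{−(N_s+2N−2)λ/2}·∑_{j=0}^{N_s+2N−2} b_j e^{jλ} for some b_0,…,b_{N_s+2N−2} ∈ ℂ; (ii) if in addition F_Q is identically zero and Q is not identically zero, then c_0 ≠ 0 and c_{N_s} ≠ 0. -/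
open Complex Finset

noncomputable section

section TQPolynomial

open Polynomial

/-- The polynomial in `e^λ` representing `e^{Nλ} ∏ₙ sinh (λ + u_n)`. -/
def sinhProdPoly {N : ℕ} (u : Fin N → ℂ) : ℂ[X] :=
  ∏ n, (C (Complex.exp (u n) / 2) * X ^ 2 - C (Complex.exp (-u n) / 2))

/-- The polynomial in `e^λ` obtained from the functional TQ-expression
`t(λ) Q(λ) + a(λ) Q(λ - η) - d(λ) Q(λ + η)` by clearing negative exponentials. -/
def tqPoly {N : ℕ} (T P : ℂ[X]) (u v : Fin N → ℂ) (κ η : ℂ) : ℂ[X] :=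
  X * T * P + C (Complex.exp κ) * (sinhProdPoly u * P.comp (C (Complex.exp (-η)) * X))
    - C (Complex.exp (-κ)) * (sinhProdPoly v * P.comp (C (Complex.exp η) * X))

lemma prod_sinh_eq {N : ℕ} (u : Fin N → ℂ) (lam : ℂ) :
    ∏ n, Complex.sinh (lam + u n) =
      Complex.exp (-(N : ℂ) * lam) * (sinhProdPoly u).eval (Complex.exp lam) := by
  have h : Complex.exp (-(N : ℂ) * lam) = ∏ _n : Fin N, Complex.exp (-lam) := by
    rw [Finset.prod_const, Finset.card_univ, Fintype.card_fin, ← Complex.exp_nat_mul]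
    ring_nf
  rw [h, sinhProdPoly, eval_prod, ← Finset.prod_mul_distrib]
  refine Finset.prod_congr rfl fun n _ => ?_
  simp only [eval_sub, eval_mul, eval_C, eval_pow, eval_X, Complex.sinh]
  rw [neg_add, Complex.exp_add, Complex.exp_add]
  have : Complex.exp (-lam) * Complex.exp lam = 1 := by
    rw [← Complex.exp_add]; simp
  linear_combination (-(Complex.exp (u n) * Complex.exp lam) / 2) * this

lemma sinhProdPoly_natDegree_le {N : ℕ} (u : Fin N → ℂ) :
    (sinhProdPoly u).natDegree ≤ 2 * N := by
  refine (natDegree_prod_le _ _).trans ((Finset.sum_le_card_nsmul _ _ 2 fun n _ => ?_).trans ?_)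
  · compute_degree
  · simp [mul_comm]

lemma sinhProdPoly_coeff_zero {N : ℕ} (u : Fin N → ℂ) :
    (sinhProdPoly u).coeff 0 = (-1 / 2) ^ N * Complex.exp (-∑ n, u n) := by
  have h : ((-1 / 2 : ℂ)) ^ N = ∏ _n : Fin N, (-1 / 2 : ℂ) := by
    rw [Finset.prod_const, Finset.card_univ, Fintype.card_fin]
  rw [sinhProdPoly, coeff_zero_prod, ← Finset.sum_neg_distrib, Complex.exp_sum, h,
    ← Finset.prod_mul_distrib]
  refine Finset.prod_congr rfl fun n _ => ?_
  simp
  ring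

lemma sinhProdPoly_coeff_top {N : ℕ} (u : Fin N → ℂ) :
    (sinhProdPoly u).coeff (2 * N) = (1 / 2) ^ N * Complex.exp (∑ n, u n) := by
  have h : ((1 / 2 : ℂ)) ^ N = ∏ _n : Fin N, (1 / 2 : ℂ) := by simp
  have hd := coeff_prod_of_natDegree_le (s := Finset.univ)
    (fun n => C (Complex.exp (u n) / 2) * X ^ 2 - C (Complex.exp (-u n) / 2)) 2
    (fun n _ => by compute_degree)
  rw [Finset.card_univ, Fintype.card_fin, mul_comm] at hd
  rw [sinhProdPoly, hd, Complex.exp_sum, h, ← Finset.prod_mul_distrib]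
  refine Finset.prod_congr rfl fun n _ => ?_
  simp [coeff_X_pow]
  ring

lemma coeff_mul_of_coeff_eq_zero_of_lt (p q : ℂ[X]) (k : ℕ) (h : ∀ j < k, q.coeff j = 0) :
    (p * q).coeff k = p.coeff 0 * q.coeff k := by
  rw [coeff_mul]
  refine Finset.sum_eq_single (0, k) (fun x hx hne => ?_) (by simp)
  rw [Finset.HasAntidiagonal.mem_antidiagonal] at hx
  rw [h, mul_zero]
  by_contra hlt
  exact hne (Prod.ext (by simp; omega) (by simp; omega))

lemma natDegree_comp_C_mul_X_le (p : ℂ[X]) (r : ℂ) :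
    (p.comp (C r * X)).natDegree ≤ p.natDegree :=
  natDegree_comp_le.trans
    ((Nat.mul_le_mul_left _ ((natDegree_C_mul_le r X).trans natDegree_X_le)).trans (mul_one _).le)

lemma tqPoly_coeff_low {N : ℕ} (T P : ℂ[X]) (u v : Fin N → ℂ) (κ η : ℂ)
    (huv : ∑ n, u n - ∑ n, v n = 2 * κ) (k : ℕ) (h : ∀ j < k, P.coeff j = 0) :
    (tqPoly T P u v κ η).coeff k =
      (-1 / 2) ^ N * Complex.exp (κ - ∑ n, u n) * (-2 * Complex.sinh (k * η)) * P.coeff k := by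
  have hv : -∑ n, v n = 2 * κ - ∑ n, u n := by linear_combination huv
  have hc : ∀ r : ℂ, ∀ j < k, (P.comp (C r * X)).coeff j = 0 := fun r j hj => by
    rw [comp_C_mul_X_coeff, h j hj, zero_mul]
  rw [tqPoly, coeff_sub, coeff_add, coeff_C_mul, coeff_C_mul,
    coeff_mul_of_coeff_eq_zero_of_lt _ _ _ h, coeff_mul_of_coeff_eq_zero_of_lt _ _ _ (hc _),
    coeff_mul_of_coeff_eq_zero_of_lt _ _ _ (hc _), sinhProdPoly_coeff_zero,
    sinhProdPoly_coeff_zero, comp_C_mul_X_coeff, comp_C_mul_X_coeff, hv, ← Complex.exp_nat_mul,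
    ← Complex.exp_nat_mul, mul_coeff_zero, coeff_X_zero, Complex.sinh]
  have e1 : Complex.exp (κ - ∑ n, u n) = Complex.exp κ * Complex.exp (-∑ n, u n) := by
    rw [← Complex.exp_add]; ring_nf
  have e2 : Complex.exp (κ - ∑ n, u n) = Complex.exp (-κ) * Complex.exp (2 * κ - ∑ n, u n) := by
    rw [← Complex.exp_add]; ring_nf
  rw [mul_neg]
  linear_combination (-(-1 / 2) ^ N * Complex.exp (-(k * η)) * P.coeff k) * e1 +
    ((-1 / 2) ^ N * Complex.exp (k * η) * P.coeff k) * e2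

lemma tqPoly_coeff_high {N : ℕ} (T P : ℂ[X]) (hT : T.natDegree + 1 < 2 * N)
    (u v : Fin N → ℂ) (κ η : ℂ)
    (huv : ∑ n, u n - ∑ n, v n = 2 * κ) (k : ℕ) (h : P.natDegree ≤ k) :
    (tqPoly T P u v κ η).coeff (2 * N + k) =
      (1 / 2) ^ N * Complex.exp (∑ n, u n - κ) * (2 * Complex.sinh (2 * κ - k * η)) *
        P.coeff k := by
  have hv : ∑ n, v n = ∑ n, u n - 2 * κ := by linear_combination -huv
  have hc : ∀ r : ℂ, (P.comp (C r * X)).natDegree ≤ k := fun r =>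
    (natDegree_comp_C_mul_X_le P r).trans h
  have h0 : (X * T * P).coeff (2 * N + k) = 0 := by
    refine coeff_eq_zero_of_natDegree_lt ?_
    have h1 : (X * T * P).natDegree ≤ (X * T).natDegree + P.natDegree := natDegree_mul_le
    have h2 : (X * T).natDegree ≤ (X : ℂ[X]).natDegree + T.natDegree := natDegree_mul_le
    rw [natDegree_X] at h2
    omega
  rw [tqPoly, coeff_sub, coeff_add, coeff_C_mul, coeff_C_mul, h0,
    coeff_mul_add_eq_of_natDegree_le (sinhProdPoly_natDegree_le u) (hc _),
    coeff_mul_add_eq_of_natDegree_le (sinhProdPoly_natDegree_le v) (hc _),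
    sinhProdPoly_coeff_top, sinhProdPoly_coeff_top, comp_C_mul_X_coeff, comp_C_mul_X_coeff, hv,
    ← Complex.exp_nat_mul, ← Complex.exp_nat_mul, Complex.sinh]
  have e1 : Complex.exp (∑ n, u n - κ) * Complex.exp (2 * κ - k * η) =
      Complex.exp κ * Complex.exp (∑ n, u n) * Complex.exp (k * -η) := by
    simp only [← Complex.exp_add]; ring_nf
  have e2 : Complex.exp (∑ n, u n - κ) * Complex.exp (-(2 * κ - k * η)) =
      Complex.exp (-κ) * Complex.exp (∑ n, u n - 2 * κ) * Complex.exp (k * η) := by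
    simp only [← Complex.exp_add]; ring_nf
  linear_combination (-(1 / 2) ^ N * P.coeff k) * e1 + ((1 / 2) ^ N * P.coeff k) * e2

lemma tqPoly_natDegree_le {N : ℕ} (T P : ℂ[X]) (hT : T.natDegree + 1 < 2 * N)
    (u v : Fin N → ℂ) (κ η : ℂ) (k : ℕ) (h : P.natDegree ≤ k) :
    (tqPoly T P u v κ η).natDegree ≤ 2 * N + k := by
  have hc : ∀ r s : ℂ, ∀ w : Fin N → ℂ,
      (C s * (sinhProdPoly w * P.comp (C r * X))).natDegree ≤ 2 * N + k := fun r s w =>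
    (natDegree_C_mul_le _ _).trans (natDegree_mul_le.trans (add_le_add
      (sinhProdPoly_natDegree_le w) ((natDegree_comp_C_mul_X_le P r).trans h)))
  refine natDegree_sub_le_of_le (natDegree_add_le_of_degree_le ?_ (hc _ _ _)) (hc _ _ _) |>.trans
    (max_self _).le
  have h1 : (X * T * P).natDegree ≤ (X * T).natDegree + P.natDegree := natDegree_mul_le
  have h2 : (X * T).natDegree ≤ (X : ℂ[X]).natDegree + T.natDegree := natDegree_mul_le
  rw [natDegree_X] at h2
  omega

lemma eq_zero_of_eval_exp_eq_zero (p : ℂ[X]) (h : ∀ lam : ℂ, p.eval (Complex.exp lam) = 0) :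
    p = 0 := by
  have hX : X * p = 0 := by
    refine Polynomial.funext fun z => ?_
    rcases eq_or_ne z 0 with rfl | hz
    · simp
    · have := h (Complex.log z)
      rw [Complex.exp_log hz] at this
      simp [this]
  exact (mul_eq_zero.mp hX).resolve_left X_ne_zero

lemma sum_fin_C_mul_X_pow_natDegree_le {m : ℕ} (c : Fin (m + 1) → ℂ) :
    (∑ j, C (c j) * X ^ (j : ℕ) : ℂ[X]).natDegree ≤ m :=
  natDegree_sum_le_of_forall_le _ _ fun j _ =>
    (natDegree_C_mul_X_pow_le _ _).trans (Nat.lt_succ_iff.mp j.2)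

lemma sum_fin_C_mul_X_pow_coeff {m : ℕ} (c : Fin (m + 1) → ℂ) (k : Fin (m + 1)) :
    (∑ j, C (c j) * X ^ (j : ℕ) : ℂ[X]).coeff k = c k := by
  simp [coeff_C_mul, coeff_X_pow, Fin.val_inj]

lemma sinh_nat_mul_ne_zero {η : ℂ} (hη : ∀ r : ℚ, η ≠ (r : ℂ) * ((Real.pi : ℂ) * Complex.I))
    {k : ℕ} (hk : k ≠ 0) : Complex.sinh (k * η) ≠ 0 := by
  intro h
  have h2 : Complex.exp (k * η) = Complex.exp (-(k * η)) := by
    rw [Complex.sinh] at h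
    linear_combination 2 * h
  obtain ⟨n, hn⟩ := Complex.exp_eq_exp_iff_exists_int.mp h2
  refine hη ((n : ℚ) / k) ?_
  have hk' : (k : ℂ) ≠ 0 := by exact_mod_cast hk
  push_cast
  field_simp
  linear_combination hn / 2

end TQPolynomial

theorem stmt_17 {N : ℕ} (hN : 1 ≤ N) (σ : Fin N → ℕ) (hσ : ∀ n, 1 ≤ σ n)
    (η : ℂ) (hη : ∀ r : ℚ, η ≠ (r : ℂ) * ((Real.pi : ℂ) * Complex.I))
    (ξ : Fin N → ℂ)
    (t : ℂ → ℂ) (ht : tForm N t)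
    (c : Fin ((∑ n, σ n) + 1) → ℂ) (Q : ℂ → ℂ)
    (hQ : ∀ lam : ℂ, Q lam =
      Complex.exp (-((∑ n, σ n : ℕ) : ℂ) * lam / 2) * ∑ j, c j * Complex.exp (((j : ℕ) : ℂ) * lam))
    (F : ℂ → ℂ)
    (hF : ∀ lam : ℂ, F lam = t lam * Q lam
      + afun η σ ξ lam * Q (lam - η) - dfun η σ ξ lam * Q (lam + η)) :
    (∃ b : Fin ((∑ n, σ n) + 2 * N - 1) → ℂ, ∀ lam : ℂ,
      F lam = Complex.exp (-(((∑ n, σ n : ℕ) : ℂ) + 2 * (N : ℂ) - 2) * lam / 2)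
        * ∑ j, b j * Complex.exp (((j : ℕ) : ℂ) * lam)) ∧
    ((∀ lam : ℂ, F lam = 0) → ¬(∀ lam : ℂ, Q lam = 0) →
      c 0 ≠ 0 ∧ c (Fin.last (∑ n, σ n)) ≠ 0) := by
  obtain ⟨τ, hτ⟩ := ht
  revert c
  generalize hM : ∑ n, σ n = M
  intro c hQ
  set T : Polynomial ℂ := ∑ j, Polynomial.C (τ j) * Polynomial.X ^ (2 * (j : ℕ)) with hTdef
  set P : Polynomial ℂ := ∑ j, Polynomial.C (c j) * Polynomial.X ^ (j : ℕ) with hPdef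
  set u : Fin N → ℂ := fun n => -ξ n + (σ n : ℂ) / 2 * η with hu
  set v : Fin N → ℂ := fun n => -ξ n - (σ n : ℂ) / 2 * η with hv
  set κ : ℂ := (M : ℂ) * η / 2 with hκ
  have hTd : T.natDegree + 1 < 2 * N := by
    have : T.natDegree ≤ 2 * N - 2 := Polynomial.natDegree_sum_le_of_forall_le _ _ fun j _ =>
      (Polynomial.natDegree_C_mul_X_pow_le _ _).trans (by have := j.2; omega)
    omega
  have hPd : P.natDegree ≤ M := sum_fin_C_mul_X_pow_natDegree_le c
  have hPc : ∀ k, P.coeff (k : Fin (M + 1)) = c k := sum_fin_C_mul_X_pow_coeff c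
  have huv : ∑ n, u n - ∑ n, v n = 2 * κ := by
    rw [← Finset.sum_sub_distrib, hκ, ← hM]
    push_cast
    rw [Finset.sum_mul, Finset.sum_div, Finset.mul_sum]
    exact Finset.sum_congr rfl fun n _ => by simp only [hu, hv]; ring
  have hTe : ∀ lam, t lam =
      Complex.exp (-((N : ℂ) - 1) * lam) * T.eval (Complex.exp lam) := fun lam => by
    rw [hτ, hTdef, Polynomial.eval_finsetSum]
    congr 1
    refine Finset.sum_congr rfl fun j _ => ?_
    rw [Polynomial.eval_mul, Polynomial.eval_C, Polynomial.eval_pow, Polynomial.eval_X,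
      ← Complex.exp_nat_mul]
    push_cast
    rfl
  have hQe : ∀ lam, Q lam =
      Complex.exp (-(M : ℂ) * lam / 2) * P.eval (Complex.exp lam) := fun lam => by
    rw [hQ, hPdef, Polynomial.eval_finsetSum]
    congr 1
    refine Finset.sum_congr rfl fun j _ => ?_
    rw [Polynomial.eval_mul, Polynomial.eval_C, Polynomial.eval_pow, Polynomial.eval_X,
      ← Complex.exp_nat_mul]
  have hae : ∀ lam, afun η σ ξ lam =
      Complex.exp (-(N : ℂ) * lam) * (sinhProdPoly u).eval (Complex.exp lam) := fun lam => by
    rw [← prod_sinh_eq, afun]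
    exact Finset.prod_congr rfl fun n _ => by simp only [hu]; ring_nf
  have hde : ∀ lam, dfun η σ ξ lam =
      Complex.exp (-(N : ℂ) * lam) * (sinhProdPoly v).eval (Complex.exp lam) := fun lam => by
    rw [← prod_sinh_eq, dfun]
    exact Finset.prod_congr rfl fun n _ => by simp only [hv]; ring_nf
  set G := tqPoly T P u v κ η with hG
  have hFe : ∀ lam, F lam =
      Complex.exp (-((N : ℂ) + M / 2) * lam) * G.eval (Complex.exp lam) := fun lam => by
    have e1 : Complex.exp (-((N : ℂ) - 1) * lam) * Complex.exp (-(M : ℂ) * lam / 2) =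
        Complex.exp (-((N : ℂ) + M / 2) * lam) * Complex.exp lam := by
      simp only [← Complex.exp_add]; ring_nf
    have e2 : Complex.exp (-(N : ℂ) * lam) * Complex.exp (-(M : ℂ) * (lam - η) / 2) =
        Complex.exp (-((N : ℂ) + M / 2) * lam) * Complex.exp κ := by
      simp only [← Complex.exp_add, hκ]; ring_nf
    have e3 : Complex.exp (-(N : ℂ) * lam) * Complex.exp (-(M : ℂ) * (lam + η) / 2) =
        Complex.exp (-((N : ℂ) + M / 2) * lam) * Complex.exp (-κ) := by
      simp only [← Complex.exp_add, hκ]; ring_nf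
    have e4 : Complex.exp (lam - η) = Complex.exp (-η) * Complex.exp lam := by
      rw [← Complex.exp_add]; ring_nf
    have e5 : Complex.exp (lam + η) = Complex.exp η * Complex.exp lam := by
      rw [← Complex.exp_add]; ring_nf
    rw [hF, hTe, hQe, hQe, hQe, hae, hde, hG, tqPoly, e4, e5]
    simp only [Polynomial.eval_sub, Polynomial.eval_add, Polynomial.eval_mul, Polynomial.eval_C,
      Polynomial.eval_X, Polynomial.eval_comp]
    linear_combination
      (T.eval (Complex.exp lam) * P.eval (Complex.exp lam)) * e1 +
      ((sinhProdPoly u).eval (Complex.exp lam) *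
        P.eval (Complex.exp (-η) * Complex.exp lam)) * e2 -
      ((sinhProdPoly v).eval (Complex.exp lam) *
        P.eval (Complex.exp η * Complex.exp lam)) * e3
  refine ⟨⟨fun j => G.coeff (j + 1), fun lam => ?_⟩, fun hF0 hQ0 => ?_⟩
  · have hG0 : G.coeff 0 = 0 := by
      rw [hG, tqPoly_coeff_low T P u v κ η huv 0 (by simp)]
      simp
    have hGtop : G.coeff (2 * N + M) = 0 := by
      rw [hG, tqPoly_coeff_high T P hTd u v κ η huv M hPd, hκ,
        show 2 * ((M : ℂ) * η / 2) - M * η = 0 by ring]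
      simp
    have hGd : G.natDegree < (M + 2 * N - 1) + 1 + 1 := by
      have := tqPoly_natDegree_le T P hTd u v κ η M hPd
      rw [← hG] at this
      omega
    have e1 : Complex.exp (-((N : ℂ) + M / 2) * lam) * Complex.exp lam =
        Complex.exp (-((M : ℂ) + 2 * N - 2) * lam / 2) := by
      rw [← Complex.exp_add]; ring_nf
    rw [hFe, Polynomial.eval_eq_sum_range' hGd, Finset.sum_range_succ,
      show M + 2 * N - 1 + 1 = 2 * N + M by omega, hGtop,
      show 2 * N + M = M + 2 * N - 1 + 1 by omega, Finset.sum_range_succ', hG0, ← e1,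
      Finset.sum_range, mul_assoc, Finset.mul_sum (a := Complex.exp lam)]
    simp only [zero_mul, add_zero]
    congr 1
    refine Finset.sum_congr rfl fun j _ => ?_
    rw [Complex.exp_nat_mul]
    ring
  · have hGz : G = 0 := eq_zero_of_eval_exp_eq_zero G fun lam => by
      have := hFe lam
      rw [hF0] at this
      exact (mul_eq_zero.mp this.symm).resolve_left (Complex.exp_ne_zero _)
    have hP0 : P ≠ 0 := fun h => hQ0 fun lam => by rw [hQe, h]; simp
    constructor
    · intro hc0
      have hex : ∃ k, P.coeff k ≠ 0 := by
        by_contra! h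
        exact hP0 (Polynomial.ext h)
      classical
      have hk := Nat.find_spec hex
      have hmin : ∀ j < Nat.find hex, P.coeff j = 0 := fun j hj =>
        not_not.mp (Nat.find_min hex hj)
      generalize Nat.find hex = k at hk hmin
      have hk0 : k ≠ 0 := by
        rintro rfl
        exact hk ((hPc 0).trans hc0)
      have hcoef := tqPoly_coeff_low T P u v κ η huv k hmin
      rw [← hG, hGz, Polynomial.coeff_zero] at hcoef
      have := sinh_nat_mul_ne_zero hη hk0
      simp [this, hk, Complex.exp_ne_zero] at hcoef
    · intro hcM
      have hk : P.natDegree ≠ M := fun h => by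
        refine hP0 (Polynomial.leadingCoeff_eq_zero.mp ?_)
        rw [Polynomial.leadingCoeff, h]
        exact (hPc (Fin.last M)).trans hcM
      have hcoef := tqPoly_coeff_high T P hTd u v κ η huv P.natDegree le_rfl
      have hs := sinh_nat_mul_ne_zero hη (k := M - P.natDegree) (by omega)
      rw [Nat.cast_sub hPd, show ((M : ℂ) - P.natDegree) * η = 2 * κ - P.natDegree * η by
        rw [hκ]; ring] at hs
      rw [← hG, hGz, Polynomial.coeff_zero] at hcoef
      simp [hs, hP0, Complex.exp_ne_zero] at hcoef
end
end
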